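/- arXiv:2209.15571 — 3 statements merged into one kernel-verified Lean document; each statement's English description precedes it below -/
import Mathlib

section
/- The stochastic interpolant x_t = I_t(x0,x1), with x0 ~ ρ0 and x1 ~ ρ1 independent, has for each t ∈ [0,1] a probability density ρ_t on ℝ^d given by the Fourier inversion formula ρ_t(x) = (2π)^{−d} ∫_{ℝ^d} ∫_{ℝ^d×ℝ^d} e^{−ik·(x − I_t(x0,x1))} ρ0(x0) ρ1(x1) dx0 dx1 dk. -/
open MeasureTheory Real Set
open scoped RealInnerProductSpace ENNReal

/-- The measure on `ℝ^d` with Lebesgue density `ρ`. -/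
noncomputable def densMeasure {d : ℕ} (ρ : EuclideanSpace ℝ (Fin d) → ℝ) :
    Measure (EuclideanSpace ℝ (Fin d)) :=
  volume.withDensity fun x => ENNReal.ofReal (ρ x)

lemma integral_withDensity_ofReal {α : Type*} [MeasurableSpace α] {μ : Measure α} {f : α → ℝ} (hf : Measurable f)
    (hf0 : ∀ x, 0 ≤ f x) (g : α → ℂ) :
    ∫ x, g x ∂μ.withDensity (fun x => ENNReal.ofReal (f x)) = ∫ x, f x * g x ∂μ := by
  rw [integral_withDensity_eq_integral_toReal_smul (by fun_prop) (by simp)]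
  simp [hf0]

section FourierInversion

open FourierTransform

variable {V : Type*} [NormedAddCommGroup V] [InnerProductSpace ℝ V] [FiniteDimensional ℝ V]
  [MeasurableSpace V] [BorelSpace V]

lemma integral_mul_fourier_charFun {μ : Measure V} [IsFiniteMeasure μ]
    (hμ : Integrable (charFun μ)) {g : V → ℂ} (hgc : Continuous g) (hg : Integrable g)
    (hg' : Integrable (𝓕 g)) :
    ∫ x, g x * 𝓕 (fun v => charFun μ ((2 * π) • v)) x = ∫ x, g x ∂μ := by
  have hφ : Integrable (fun v => charFun μ ((2 * π) • v)) := hμ.comp_smul (by positivity)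
  have h1 := VectorFourier.integral_fourierIntegral_smul_eq_flip (μ := volume) (ν := volume)
    (L := innerₗ V) Real.continuous_fourierChar continuous_inner hg hφ
  have h2 := VectorFourier.integral_fourierIntegral_smul_eq_flip (μ := volume) (ν := μ)
    (L := -innerₗ V) Real.continuous_fourierChar (by simp; fun_prop) hg'
    (integrable_const (1 : ℂ))
  rw [flip_innerₗ] at h1
  change ∫ v, 𝓕 g v * _ = ∫ x, g x * 𝓕 (fun v => charFun μ ((2 * π) • v)) x at h1
  simp only [smul_eq_mul, mul_one] at h2
  have h3 : ∀ x, VectorFourier.fourierIntegral 𝐞 volume (-innerₗ V) (𝓕 g) x = g x := by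
    intro x
    conv_rhs => rw [← hgc.fourierInv_fourier_eq hg hg']
    rw [Real.fourierInv_eq]
    simp [VectorFourier.fourierIntegral]
  simp_rw [h3] at h2
  rw [← h1, h2]
  congr with v
  rw [charFun_apply]
  congr 1
  simp only [VectorFourier.fourierIntegral, Circle.smul_def, Real.fourierChar_apply]
  congr with x
  simp [inner_smul_right, real_inner_comm]

lemma fourier_charFun_eq (μ : Measure V) (x : V) :
    𝓕 (fun v => charFun μ ((2 * π) • v)) x =
      (((2 * π) ^ Module.finrank ℝ V)⁻¹ : ℝ) *
        ∫ k, Complex.exp (-(Complex.I * (⟪k, x⟫ : ℝ))) * charFun μ k := by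
  have h := Measure.integral_comp_smul (volume : Measure V)
    (fun k => Complex.exp (-(Complex.I * (⟪k, x⟫ : ℝ))) * charFun μ k) (2 * π)
  rw [abs_of_nonneg (by positivity), Complex.real_smul] at h
  rw [← h, Real.fourier_eq']
  congr with v
  simp [inner_smul_left]
  left; congr 1; ring

lemma conj_fourier_charFun (μ : Measure V) (x : V) :
    (starRingEnd ℂ) (𝓕 (fun v => charFun μ ((2 * π) • v)) x) =
      𝓕 (fun v => charFun μ ((2 * π) • v)) x := by
  rw [Real.fourier_eq', ← integral_conj, ← integral_neg_eq_self]
  congr with v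
  simp [← Complex.exp_conj, Complex.conj_ofNat]

lemma integrable_fourier_gaussian (t : V) :
    Integrable (𝓕 (fun v : V => Complex.exp (-1 * ‖v‖ ^ 2 + 2 * π * Complex.I * ⟪t, v⟫))) := by
  have h : (𝓕 (fun v : V => Complex.exp (-1 * ‖v‖ ^ 2 + 2 * π * Complex.I * ⟪t, v⟫))) = _ :=
    funext fun w => fourier_gaussian_innerProductSpace' (b := 1) (by simp) t w
  rw [h]
  apply Integrable.const_mul
  have h := GaussianFourier.integrable_cexp_neg_mul_sq_norm_add (V := V) (b := (π : ℂ) ^ 2)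
    (by rw [← Complex.ofReal_pow, Complex.ofReal_re]; positivity) 0 0
  convert h.comp_sub_left t using 2 with w
  simp

/-- A finite measure and a bounded function with the same integrals against all modulated
Gaussians: the function is a density of the measure. -/
lemma eq_withDensity_of_integral_gaussian {μ : Measure V} [IsFiniteMeasure μ] {p : V → ℝ}
    (hp : Measurable p) {C : ℝ} (hC : ∀ x, |p x| ≤ C)
    (h : ∀ t : V, ∫ x, Complex.exp (-1 * ‖x‖ ^ 2 + 2 * π * Complex.I * ⟪t, x⟫) * p x =
      ∫ x, Complex.exp (-1 * ‖x‖ ^ 2 + 2 * π * Complex.I * ⟪t, x⟫) ∂μ) :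
    μ = volume.withDensity fun x => ENNReal.ofReal (p x) := by
  set w : V → ℝ := fun x => rexp (-1 * ‖x‖ ^ 2) with hw
  have hwm : Measurable w := by fun_prop
  have hw0 : ∀ x, 0 < w x := fun x => exp_pos _
  have hwint : Integrable w := by
    have := (GaussianFourier.integrable_cexp_neg_mul_sq_norm_add (V := V) (b := 1)
      (by simp) 0 0).re
    convert this using 2 with x
    simp only [hw]
    rw [← Complex.ofReal_re (rexp _)]
    simp
  have hwint' : Integrable w μ := by
    refine Integrable.of_bound (C := 1) hwm.aestronglyMeasurable (ae_of_all _ fun x => ?_)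
    simp [hw]
  have hbound : ∀ q : V → ℝ, Measurable q → (∀ x, |q x| ≤ C) →
      Integrable fun x => q x * w x := fun q hq hqC =>
    hwint.bdd_mul hq.aestronglyMeasurable (ae_of_all _ hqC)
  have hpos := hbound (fun x => max (p x) 0) (by fun_prop) fun x =>
    (abs_max_le_max_abs_abs).trans (by simp [hC x])
  have hneg := hbound (fun x => max (-p x) 0) (by fun_prop) fun x =>
    (abs_max_le_max_abs_abs).trans (by simp [hC x])
  have := isFiniteMeasure_withDensity_ofReal hwint'.2
  have := isFiniteMeasure_withDensity_ofReal hpos.2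
  have := isFiniteMeasure_withDensity_ofReal hneg.2
  have hchar : ∀ t x : V, (w x : ℂ) * Complex.exp (⟪x, t⟫ * Complex.I) =
      Complex.exp (-1 * ‖x‖ ^ 2 + 2 * π * Complex.I * ⟪(2 * π)⁻¹ • t, x⟫) := by
    intro t x
    rw [hw, Complex.ofReal_exp, ← Complex.exp_add]
    congr 1
    rw [inner_smul_left, real_inner_comm]
    push_cast
    have : (π : ℂ) ≠ 0 := by simp [pi_ne_zero]
    simp
    field_simp
  have hbdd : ∀ (t : V) (ν : Measure V) [IsFiniteMeasure ν],
      Integrable (fun x => Complex.exp (⟪x, t⟫ * Complex.I)) ν := fun t ν _ =>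
    Integrable.of_bound (C := 1) (by fun_prop) (ae_of_all _ fun x => by
      simp [Complex.norm_exp_ofReal_mul_I])
  have key : μ.withDensity (fun x => ENNReal.ofReal (w x)) +
      volume.withDensity (fun x => ENNReal.ofReal (max (-p x) 0 * w x)) =
      volume.withDensity (fun x => ENNReal.ofReal (max (p x) 0 * w x)) := by
    apply Measure.ext_of_charFun
    ext t
    simp only [charFun_apply]
    rw [integral_add_measure (hbdd _ _) (hbdd _ _),
      integral_withDensity_ofReal hwm (fun x => (hw0 x).le),
      integral_withDensity_ofReal (by fun_prop) (fun x => mul_nonneg (by simp) (hw0 x).le),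
      integral_withDensity_ofReal (by fun_prop) (fun x => mul_nonneg (by simp) (hw0 x).le)]
    have hm : ∀ q : V → ℝ, Integrable q →
        Integrable fun x => (q x : ℂ) * Complex.exp (⟪x, t⟫ * Complex.I) := fun q hq =>
      hq.ofReal.mul_bdd (c := 1) (by fun_prop)
        (ae_of_all _ fun x => by simp [Complex.norm_exp_ofReal_mul_I])
    rw [← eq_sub_iff_add_eq, ← integral_sub (hm _ hpos) (hm _ hneg)]
    simp_rw [hchar, ← h, ← hchar]
    congr with x
    have : p x = max (p x) 0 - max (-p x) 0 := by
      rcases le_total 0 (p x) with h | h <;> simp [h]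
    nth_rw 1 [this]
    push_cast
    ring
  have hmul : ∀ q : V → ℝ, Measurable q →
      volume.withDensity (fun x => ENNReal.ofReal (max (q x) 0 * w x)) =
      (volume.withDensity fun x => ENNReal.ofReal (q x)).withDensity
        fun x => ENNReal.ofReal (w x) := by
    intro q hq
    rw [← withDensity_mul _ (by fun_prop) (by fun_prop)]
    congr with x
    simp [ENNReal.ofReal_mul]
  rw [hmul _ hp, hmul (fun x => -p x) (by fun_prop), ← withDensity_add_measure] at key
  have hinv : ∀ ν : Measure V, (ν.withDensity fun x => ENNReal.ofReal (w x)).withDensity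
      (fun x => ENNReal.ofReal (w x))⁻¹ = ν := fun ν =>
    withDensity_inv_same (by fun_prop) (ae_of_all _ fun x => by simp [hw0 x]) (by simp)
  replace key := congrArg (fun ν => ν.withDensity (fun x => ENNReal.ofReal (w x))⁻¹) key
  simp only [hinv] at key
  have hA : MeasurableSet {x | p x < 0} := measurableSet_lt hp measurable_const
  have hzero : volume.withDensity (fun x => ENNReal.ofReal (-p x)) = 0 := by
    rw [withDensity_eq_zero_iff (by fun_prop)]
    have h0 := congrArg (fun ν => ν {x | p x < 0}) key
    simp only [Measure.add_apply] at h0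
    rw [withDensity_apply _ hA, withDensity_apply _ hA,
      setLIntegral_congr_fun (f := fun x => ENNReal.ofReal (p x)) (g := 0) hA
        (fun x hx => ENNReal.ofReal_of_nonpos (le_of_lt hx))] at h0
    simp only [Pi.zero_apply, lintegral_zero, add_eq_zero] at h0
    have h1 := (setLIntegral_eq_zero_iff hA (by fun_prop)).1 h0.2
    filter_upwards [h1] with x hx
    by_cases hxA : p x < 0
    · exact hx hxA
    · simpa using hxA
  rwa [hzero, add_zero] at key

/-- **Fourier inversion for measures**: a finite measure with integrable characteristic function
has the inverse Fourier transform of that function as a density. -/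
lemma eq_withDensity_fourier_charFun {μ : Measure V} [IsFiniteMeasure μ]
    (hμ : Integrable (charFun μ)) :
    μ = volume.withDensity fun x =>
      ENNReal.ofReal (𝓕 (fun v => charFun μ ((2 * π) • v)) x).re := by
  have hφ : Integrable (fun v => charFun μ ((2 * π) • v)) := hμ.comp_smul (by positivity)
  have hcont : Continuous (𝓕 (fun v => charFun μ ((2 * π) • v))) :=
    VectorFourier.fourierIntegral_continuous Real.continuous_fourierChar
      continuous_inner hφ
  refine eq_withDensity_of_integral_gaussian (Complex.continuous_re.comp hcont).measurable
    (fun x => (Complex.abs_re_le_norm _).trans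
      (VectorFourier.norm_fourierIntegral_le_integral_norm _ _ _ _ x)) fun t => ?_
  rw [← integral_mul_fourier_charFun hμ (by fun_prop)
    (GaussianFourier.integrable_cexp_neg_mul_sq_norm_add (by simp) _ _)
    (integrable_fourier_gaussian t)]
  congr with x
  rw [Complex.conj_eq_iff_re.1 (conj_fourier_charFun μ x)]

end FourierInversion

lemma isProbabilityMeasure_densMeasure {d : ℕ} {ρ : EuclideanSpace ℝ (Fin d) → ℝ}
    (hρ : ∀ x, 0 ≤ ρ x) (hρ1 : ∫ x, ρ x = 1) : IsProbabilityMeasure (densMeasure ρ) := by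
  have hint : Integrable ρ := by
    by_contra h
    simp [integral_undef h] at hρ1
  refine ⟨?_⟩
  rw [densMeasure, withDensity_apply _ MeasurableSet.univ, Measure.restrict_univ,
    ← ofReal_integral_eq_lintegral_ofReal hint (ae_of_all _ hρ), hρ1, ENNReal.ofReal_one]

lemma charFun_map_densMeasure_prod {d : ℕ} {ρ0 ρ1 : EuclideanSpace ℝ (Fin d) → ℝ}
    (hρ0nn : ∀ x, 0 ≤ ρ0 x) (hρ0m : ∫ x, ρ0 x = 1) (hρ0 : Measurable ρ0)
    (hρ1nn : ∀ x, 0 ≤ ρ1 x) (hρ1m : ∫ x, ρ1 x = 1) (hρ1 : Measurable ρ1)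
    {J : EuclideanSpace ℝ (Fin d) × EuclideanSpace ℝ (Fin d) → EuclideanSpace ℝ (Fin d)}
    (hJ : Measurable J) (k : EuclideanSpace ℝ (Fin d)) :
    charFun (((densMeasure ρ0).prod (densMeasure ρ1)).map J) k =
      ∫ x0, ∫ x1, Complex.exp (Complex.I * (⟪k, J (x0, x1)⟫ : ℝ)) * (ρ0 x0 : ℂ) * (ρ1 x1 : ℂ) := by
  have := isProbabilityMeasure_densMeasure hρ0nn hρ0m
  have := isProbabilityMeasure_densMeasure hρ1nn hρ1m
  rw [charFun_apply, integral_map hJ.aemeasurable (by fun_prop), integral_prod]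
  · rw [densMeasure, integral_withDensity_ofReal hρ0 hρ0nn]
    congr with x0
    rw [densMeasure, integral_withDensity_ofReal hρ1 hρ1nn, ← integral_const_mul]
    congr with x1
    rw [real_inner_comm, mul_comm Complex.I]
    ring
  · refine Integrable.of_bound (C := 1) (by fun_prop) (ae_of_all _ fun x => ?_)
    rw [Complex.norm_exp_ofReal_mul_I]

/-- The stochastic interpolant `x_t = I_t(x0,x1)`, with `x0 ~ ρ0` and
`x1 ~ ρ1` independent, has for each `t ∈ [0,1]` a probability density `ρ_t` given by the
Fourier inversion formula
`ρ_t(x) = (2π)^{-d} ∫_k ∫∫ e^{-ik·(x - I_t(x0,x1))} ρ0(x0) ρ1(x1) dx0 dx1 dk`. -/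
theorem stochastic_interpolant_has_density
    (d : ℕ) (ρ0 ρ1 : EuclideanSpace ℝ (Fin d) → ℝ)
    (hρ0nn : ∀ x, 0 ≤ ρ0 x) (hρ0m : ∫ x, ρ0 x = 1) (hρ0C1 : ContDiff ℝ 1 ρ0)
    (hρ1nn : ∀ x, 0 ≤ ρ1 x) (hρ1m : ∫ x, ρ1 x = 1) (hρ1C1 : ContDiff ℝ 1 ρ1)
    (I : ℝ → EuclideanSpace ℝ (Fin d) → EuclideanSpace ℝ (Fin d) → EuclideanSpace ℝ (Fin d))
    (hIC1 : ContDiff ℝ 1 fun p : ℝ × EuclideanSpace ℝ (Fin d) × EuclideanSpace ℝ (Fin d) =>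
      I p.1 p.2.1 p.2.2)
    (hI0 : ∀ x0 x1, I 0 x0 x1 = x0) (hI1 : ∀ x0 x1, I 1 x0 x1 = x1)
    (dI : ℝ → EuclideanSpace ℝ (Fin d) → EuclideanSpace ℝ (Fin d) → EuclideanSpace ℝ (Fin d))
    (hdI : ∀ t x0 x1, HasDerivAt (fun s => I s x0 x1) (dI t x0 x1) t)
    -- `E[|∂_t I_t(x0,x1)|²] < ∞`
    (hdIL2 : (∫⁻ t in Icc (0:ℝ) 1, ∫⁻ x0, ∫⁻ x1,
      ENNReal.ofReal (‖dI t x0 x1‖ ^ 2 * (ρ0 x0 * ρ1 x1))) < ⊤)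
    -- absolute integrability of the characteristic function of `x_t`
    (hF1 : ∀ t ∈ Icc (0:ℝ) 1, Integrable fun k : EuclideanSpace ℝ (Fin d) =>
      ∫ x0, ∫ x1, Complex.exp (Complex.I * (⟪k, I t x0 x1⟫ : ℝ)) * (ρ0 x0 : ℂ) * (ρ1 x1 : ℂ))
    -- absolute integrability of the Fourier transform of the current
    (hF2 : ∀ t ∈ Icc (0:ℝ) 1, Integrable fun k : EuclideanSpace ℝ (Fin d) =>
      ∫ x0, ∫ x1, (fun i => (dI t x0 x1 i : ℂ) *
        Complex.exp (Complex.I * (⟪k, I t x0 x1⟫ : ℝ)) * (ρ0 x0 : ℂ) * (ρ1 x1 : ℂ) :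
        Fin d → ℂ)) :
    ∃ ρt : ℝ → EuclideanSpace ℝ (Fin d) → ℝ, ∀ t ∈ Icc (0:ℝ) 1,
      (∀ x, (ρt t x : ℂ) = (((2 * π) ^ d)⁻¹ : ℝ) *
        ∫ k : EuclideanSpace ℝ (Fin d), ∫ x0, ∫ x1,
          Complex.exp (-(Complex.I * (⟪k, x - I t x0 x1⟫ : ℝ))) * (ρ0 x0 : ℂ) * (ρ1 x1 : ℂ)) ∧
      Measure.map (fun p : EuclideanSpace ℝ (Fin d) × EuclideanSpace ℝ (Fin d) => I t p.1 p.2)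
          ((densMeasure ρ0).prod (densMeasure ρ1)) = densMeasure (ρt t) := by
  have hchar := fun t => charFun_map_densMeasure_prod hρ0nn hρ0m hρ0C1.continuous.measurable
    hρ1nn hρ1m hρ1C1.continuous.measurable (J := fun p => I t p.1 p.2)
    (hIC1.continuous.comp (Continuous.prodMk_right t)).measurable
  refine ⟨fun t x => (FourierTransform.fourier (fun v => charFun (((densMeasure ρ0).prod
    (densMeasure ρ1)).map (fun p => I t p.1 p.2)) ((2 * π) • v)) x).re,
    fun t ht => ⟨fun x => ?_, ?_⟩⟩
  · rw [Complex.conj_eq_iff_re.1 (conj_fourier_charFun _ x), fourier_charFun_eq,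
      finrank_euclideanSpace_fin]
    congr 2 with k
    rw [hchar, ← integral_const_mul]
    congr with x0
    rw [← integral_const_mul]
    congr with x1
    rw [← mul_assoc, ← mul_assoc, ← Complex.exp_add, inner_sub_right]
    push_cast
    ring_nf
  · have := isProbabilityMeasure_densMeasure hρ0nn hρ0m
    have := isProbabilityMeasure_densMeasure hρ1nn hρ1m
    exact eq_withDensity_fourier_charFun
      ((hF1 t ht).congr (ae_of_all _ fun k => (hchar t k).symm))
end

section
/- Assume ρ0(x) = (2π)^{−d/2} e^{−|x|²/2} is the standard Gaussian density on ℝ^d and the interpolant is linear, I_t(x0,x1) = a_t x0 + b_t x1, with a_t, b_t continuously differentiable on [0,1], ȧ_t ≤ 0, ḃ_t ≥ 0, a_0 = 1, a_1 = 0, b_0 = 0, b_1 = 1, a_t > 0 on [0,1), and b_t > 0 on (0,1]. Then for every t ∈ (0,1) the probability current satisfies j_t(x) = (ḃ_t/b_t) x ρ_t(x) − a_t(ȧ_t − (ḃ_t/b_t) a_t) ∇ρ_t(x); consequently at every x with ρ_t(x) > 0 the velocity satisfies v_t(x) = (ḃ_t/b_t) x − a_t(ȧ_t − (ḃ_t/b_t)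 a_t) ∇ log ρ_t(x). -/
open MeasureTheory Real Set
open scoped RealInnerProductSpace ENNReal

section Smoothing

variable {V : Type*} [NormedAddCommGroup V] [InnerProductSpace ℝ V] [FiniteDimensional ℝ V]
  [MeasurableSpace V] [BorelSpace V]

theorem integrable_smul_comp_sub_smul {F : Type*} [NormedAddCommGroup F] [NormedSpace ℝ F]
    {ρ : V → ℝ} {K : V → F} {C : ℝ} (hρ : Integrable ρ) (hK : Continuous K)
    (hKC : ∀ z, ‖K z‖ ≤ C) (b : ℝ) (x : V) :
    Integrable fun y => ρ y • K (x - b • y) := by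
  have hm : Continuous fun y => K (x - b • y) := by fun_prop
  refine (hρ.norm.mul_const C).mono' (hρ.1.smul hm.aestronglyMeasurable) (.of_forall fun y => ?_)
  rw [norm_smul]
  gcongr
  exact hKC _

theorem continuous_integral_smul_comp_sub_smul {F : Type*} [NormedAddCommGroup F]
    [NormedSpace ℝ F] {ρ : V → ℝ} {K : V → F} {C : ℝ} (hρ : Integrable ρ) (hK : Continuous K)
    (hKC : ∀ z, ‖K z‖ ≤ C) (b : ℝ) :
    Continuous fun x => ∫ y, ρ y • K (x - b • y) := by
  refine continuous_of_dominated (bound := fun y => ‖ρ y‖ * C)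
    (fun x => (integrable_smul_comp_sub_smul hρ hK hKC b x).1) (fun x => .of_forall fun y => ?_)
    (hρ.norm.mul_const C) (.of_forall fun y => by fun_prop)
  rw [norm_smul]
  gcongr
  exact hKC _

theorem hasGradientAt_integral_smul_comp_sub_smul {ρ K : V → ℝ} {K' : V → V} {C C' : ℝ}
    (hρ : Integrable ρ) (hK : ∀ z, HasGradientAt K (K' z) z) (hK' : Continuous K')
    (hKC : ∀ z, ‖K z‖ ≤ C) (hKC' : ∀ z, ‖K' z‖ ≤ C') (b : ℝ) (x : V) :
    HasGradientAt (fun x => ∫ y, ρ y • K (x - b • y)) (∫ y, ρ y • K' (x - b • y)) x := by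
  have hKc : Continuous K :=
    continuous_iff_continuousAt.2 fun z => (hK z).hasFDerivAt.continuousAt
  set D : V → V → V →L[ℝ] ℝ := fun x y => ρ y • InnerProductSpace.toDual ℝ V (K' (x - b • y))
  have hDbound : ∀ x y, ‖D x y‖ ≤ ‖ρ y‖ * C' := fun x y => by
    simp only [D, norm_smul, LinearIsometryEquiv.norm_map]
    gcongr
    exact hKC' _
  have hDmeas : AEStronglyMeasurable (D x) := by
    refine hρ.1.smul (Continuous.aestronglyMeasurable ?_)
    exact (InnerProductSpace.toDual ℝ V).continuous.comp (by fun_prop)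
  have hDint : Integrable (D x) :=
    (hρ.norm.mul_const C').mono' hDmeas (.of_forall (hDbound x))
  have hmain : HasFDerivAt (fun x => ∫ y, ρ y • K (x - b • y)) (∫ y, D x y) x := by
    refine hasFDerivAt_integral_of_dominated_of_fderiv_le (bound := fun y => ‖ρ y‖ * C')
      Filter.univ_mem
      (.of_forall fun x => (integrable_smul_comp_sub_smul hρ hKc hKC b x).1)
      (integrable_smul_comp_sub_smul hρ hKc hKC b x) hDmeas
      (.of_forall fun y x _ => hDbound x y) (hρ.norm.mul_const C')
      (.of_forall fun y x _ => ?_)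
    have h := (hK (x - b • y)).hasFDerivAt.comp x ((hasFDerivAt_id x).sub_const (b • y))
    exact h.const_smul (ρ y)
  rw [hasGradientAt_iff_hasFDerivAt]
  refine hmain.congr_fderiv ?_
  symm
  ext w
  rw [ContinuousLinearMap.integral_apply hDint, InnerProductSpace.toDual_apply_apply,
    real_inner_comm, ← integral_inner (integrable_smul_comp_sub_smul hρ hK' hKC' b x)]
  exact integral_congr_ae (.of_forall fun y => by
    simp [D, inner_smul_right, real_inner_comm])

theorem integral_integral_comp_smul_add_smul {F : Type*} [NormedAddCommGroup F] [NormedSpace ℝ F]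
    {ρ φ w : V → ℝ} {H : V → V → F} {Cφ Cw : ℝ} (hρ : Integrable ρ) (hφ : Integrable φ)
    (hφC : ∀ x, φ x ≤ Cφ) (hw : Integrable w) (hw0 : ∀ x, 0 ≤ w x) (hwC : ∀ x, w x ≤ Cw)
    (hφ0 : ∀ x, 0 ≤ φ x)
    (hH : Continuous fun p : V × V => H p.1 p.2) (hHb : ∀ x z, ‖H x z‖ ≤ φ x * w z)
    {a : ℝ} (ha : a ≠ 0) (b : ℝ) :
    ∫ x0, ∫ x1, ρ x1 • H (a • x0 + b • x1) x0 =
      ∫ x, ∫ y, ρ y • (|a ^ Module.finrank ℝ V|⁻¹ • H x (a⁻¹ • (x - b • y))) := by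
  have hint : Integrable (Function.uncurry fun x0 x1 => ρ x1 • H (a • x0 + b • x1) x0)
      ((volume : Measure V).prod volume) := by
    have hc : Continuous fun p : V × V => H (a • p.1 + b • p.2) p.1 :=
      hH.comp (f := fun p : V × V => (a • p.1 + b • p.2, p.1)) (by fun_prop)
    refine ((hw.mul_prod hρ.norm).const_mul Cφ).mono'
      (hρ.1.comp_snd.smul hc.aestronglyMeasurable) (.of_forall fun p => ?_)
    simp only [Function.uncurry, norm_smul]
    calc ‖ρ p.2‖ * ‖H (a • p.1 + b • p.2) p.1‖ ≤ ‖ρ p.2‖ * (Cφ * w p.1) := by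
          gcongr
          exact (hHb _ _).trans (mul_le_mul_of_nonneg_right (hφC _) (hw0 _))
      _ = Cφ * (w p.1 * ‖ρ p.2‖) := by ring
  have hint' : Integrable (Function.uncurry fun x y =>
      ρ y • (|a ^ Module.finrank ℝ V|⁻¹ • H x (a⁻¹ • (x - b • y))))
      ((volume : Measure V).prod volume) := by
    have hc : Continuous fun p : V × V =>
        |a ^ Module.finrank ℝ V|⁻¹ • H p.1 (a⁻¹ • (p.1 - b • p.2)) :=
      (hH.comp (f := fun p : V × V => (p.1, a⁻¹ • (p.1 - b • p.2))) (by fun_prop)).const_smul _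
    refine ((hφ.mul_prod hρ.norm).const_mul (|a ^ Module.finrank ℝ V|⁻¹ * Cw)).mono'
      (hρ.1.comp_snd.smul hc.aestronglyMeasurable) (.of_forall fun p => ?_)
    simp only [Function.uncurry, norm_smul, norm_inv, Real.norm_eq_abs, abs_abs]
    calc |ρ p.2| * (|a ^ Module.finrank ℝ V|⁻¹ * ‖H p.1 (a⁻¹ • (p.1 - b • p.2))‖)
        ≤ |ρ p.2| * (|a ^ Module.finrank ℝ V|⁻¹ * (φ p.1 * Cw)) := by
          gcongr
          exact (hHb _ _).trans (mul_le_mul_of_nonneg_left (hwC _) (hφ0 _))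
      _ = |a ^ Module.finrank ℝ V|⁻¹ * Cw * (φ p.1 * |ρ p.2|) := by ring
  rw [integral_integral_swap hint, integral_integral_swap hint']
  refine integral_congr_ae (.of_forall fun y => ?_)
  simp only [integral_smul]
  congr 1
  have h1 := Measure.integral_comp_smul (volume : Measure V)
    (fun u => H (u + b • y) (a⁻¹ • u)) a
  have h2 := integral_sub_right_eq_self (μ := (volume : Measure V))
    (fun u => H (u + b • y) (a⁻¹ • u)) (b • y)
  simp only [inv_smul_smul₀ ha, sub_add_cancel] at h1 h2
  rw [h1, h2, abs_inv]

theorem HasCompactSupport.exists_integrable_bound {φ : V → ℝ} (hφ : Continuous φ)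
    (hφs : HasCompactSupport φ) :
    Integrable (fun x => |φ x| * (1 + ‖x‖)) ∧ ∃ C, ∀ x, |φ x| * (1 + ‖x‖) ≤ C := by
  have hc : Continuous fun x => |φ x| * (1 + ‖x‖) := by fun_prop
  have hs : HasCompactSupport fun x => |φ x| * (1 + ‖x‖) :=
    (hφs.comp_left (g := fun r : ℝ => |r|) abs_zero).mul_right
  obtain ⟨C, hC⟩ := hs.exists_bound_of_continuous hc
  exact ⟨hc.integrable_of_hasCompactSupport hs, C, fun x => (le_abs_self _).trans (hC x)⟩

theorem Continuous.eq_of_integral_smul_eq {F : Type*} [NormedAddCommGroup F] [NormedSpace ℝ F]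
    [CompleteSpace F] {f g : V → F} (hf : Continuous f) (hg : Continuous g)
    (h : ∀ φ : V → ℝ, Continuous φ → HasCompactSupport φ →
      ∫ x, φ x • f x = ∫ x, φ x • g x) : f = g :=
  (Continuous.ae_eq_iff_eq volume hf hg).1 <|
    ae_eq_of_integral_contDiff_smul_eq hf.locallyIntegrable hg.locallyIntegrable
      fun φ hφ hφs => h φ hφ.continuous hφs

end Smoothing

section Gaussian

variable {V : Type*} [NormedAddCommGroup V]

theorem one_add_norm_mul_exp_neg_sq_le (x : V) :
    (1 + ‖x‖) * Real.exp (-‖x‖ ^ 2 / 2) ≤ 2 * Real.exp (-(1 / 4) * ‖x‖ ^ 2) := by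
  have h1 : ‖x‖ ^ 2 / 4 + 1 ≤ Real.exp (‖x‖ ^ 2 / 4) := Real.add_one_le_exp _
  have h2 : 1 + ‖x‖ ≤ 2 * Real.exp (‖x‖ ^ 2 / 4) := by nlinarith [sq_nonneg (‖x‖ / 2 - 1)]
  calc (1 + ‖x‖) * Real.exp (-‖x‖ ^ 2 / 2)
      ≤ 2 * Real.exp (‖x‖ ^ 2 / 4) * Real.exp (-‖x‖ ^ 2 / 2) := by gcongr
    _ = 2 * Real.exp (-(1 / 4) * ‖x‖ ^ 2) := by
      rw [mul_assoc, ← Real.exp_add]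
      ring_nf

theorem exp_neg_mul_sq_norm_le_one (x : V) : Real.exp (-(1 / 4) * ‖x‖ ^ 2) ≤ 1 :=
  Real.exp_le_one_iff.2 (by nlinarith [sq_nonneg ‖x‖])

theorem one_add_norm_mul_exp_neg_sq_le_two (x : V) :
    (1 + ‖x‖) * Real.exp (-‖x‖ ^ 2 / 2) ≤ 2 := by
  linarith [one_add_norm_mul_exp_neg_sq_le x, exp_neg_mul_sq_norm_le_one x]

variable [InnerProductSpace ℝ V]

theorem integrable_exp_neg_mul_sq_norm [FiniteDimensional ℝ V] [MeasurableSpace V] [BorelSpace V]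
    {s : ℝ} (hs : 0 < s) : Integrable fun x : V => Real.exp (-s * ‖x‖ ^ 2) := by
  have h := GaussianFourier.integrable_cexp_neg_mul_sq_norm_add (V := V) (b := (s : ℂ))
    (by simpa using hs) 0 0
  refine h.norm.congr (.of_forall fun x => ?_)
  simp only [Complex.norm_exp]
  norm_cast
  simp

/-- The Gaussian profile of width `a` and height `k`. -/
noncomputable def gaussianProfile (k a : ℝ) (z : V) : ℝ :=
  k * Real.exp (-‖a⁻¹ • z‖ ^ 2 / 2)

theorem continuous_gaussianProfile (k a : ℝ) : Continuous (gaussianProfile (V := V) k a) := by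
  unfold gaussianProfile
  fun_prop

theorem norm_gaussianProfile_mul_le (k a : ℝ) (z : V) :
    ‖gaussianProfile k a z‖ * (1 + ‖a⁻¹ • z‖) ≤ |k| * 2 := by
  rw [gaussianProfile, norm_mul, Real.norm_eq_abs, Real.norm_eq_abs, Real.abs_exp, mul_assoc]
  gcongr
  rw [mul_comm]
  exact one_add_norm_mul_exp_neg_sq_le_two _

theorem norm_gaussianProfile_le (k a : ℝ) (z : V) : ‖gaussianProfile k a z‖ ≤ |k| * 2 :=
  (le_mul_of_one_le_right (norm_nonneg _) (by simp)).trans (norm_gaussianProfile_mul_le k a z)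

/-- The gradient of `gaussianProfile k a`. -/
noncomputable def gaussianProfileGradient (k a : ℝ) (z : V) : V :=
  -(a⁻¹ * gaussianProfile k a z) • (a⁻¹ • z)

theorem continuous_gaussianProfileGradient (k a : ℝ) :
    Continuous (gaussianProfileGradient (V := V) k a) := by
  have := continuous_gaussianProfile (V := V) k a
  unfold gaussianProfileGradient
  fun_prop

theorem norm_gaussianProfileGradient_le (k a : ℝ) (z : V) :
    ‖gaussianProfileGradient k a z‖ ≤ |a⁻¹| * (|k| * 2) := by
  rw [gaussianProfileGradient, norm_smul, norm_neg, norm_mul, mul_assoc, Real.norm_eq_abs]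
  refine mul_le_mul_of_nonneg_left
    (le_trans ?_ (norm_gaussianProfile_mul_le k a z)) (abs_nonneg _)
  gcongr
  linarith

theorem hasGradientAt_gaussianProfile [CompleteSpace V] (k a : ℝ) (z : V) :
    HasGradientAt (gaussianProfile k a) (gaussianProfileGradient k a z) z := by
  rw [hasGradientAt_iff_hasFDerivAt]
  have h1 : HasFDerivAt (fun z : V => -‖a⁻¹ • z‖ ^ 2 / 2) _ z :=
    ((hasFDerivAt_id z).const_smul a⁻¹).norm_sq.neg.mul_const (2 : ℝ)⁻¹
  refine (h1.exp.const_mul k).congr_fderiv ?_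
  ext w
  simp [gaussianProfileGradient, gaussianProfile]
  ring

variable [FiniteDimensional ℝ V] [MeasurableSpace V] [BorelSpace V]

theorem integral_smul_gaussianProfile_pos {ρ : V → ℝ} (hρ0 : ∀ x, 0 ≤ ρ x)
    (hρm : ∫ x, ρ x = 1) {k : ℝ} (hk : 0 < k) (a b : ℝ) (x : V) :
    0 < ∫ y, ρ y • gaussianProfile k a (x - b • y) := by
  have hρ : Integrable ρ := .of_integral_ne_zero (by simp [hρm])
  have hpos : ∀ z : V, 0 < gaussianProfile k a z := fun z => mul_pos hk (Real.exp_pos _)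
  refine (integral_pos_iff_support_of_nonneg (fun y => smul_nonneg (hρ0 y) (hpos _).le)
    (integrable_smul_comp_sub_smul hρ (continuous_gaussianProfile k a)
      (norm_gaussianProfile_le k a) b x)).2 ?_
  have h : 0 < ∫ x, ρ x := by simp [hρm]
  rw [integral_pos_iff_support_of_nonneg hρ0 hρ] at h
  convert h using 2
  ext y
  simp [(hpos _).ne']

/-- Transport of a kernel integral along `(x₀, x₁) ↦ a x₀ + b x₁` when `x₀` is Gaussian. -/
theorem integral_integral_gaussian_comp {F : Type*} [NormedAddCommGroup F] [NormedSpace ℝ F]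
    {ρ φ : V → ℝ} (hρ : Integrable ρ) (hφ : Continuous φ) (hφs : HasCompactSupport φ)
    {G : V → V → F} (hG : Continuous fun p : V × V => G p.1 p.2) {M : ℝ}
    (hGM : ∀ x z, ‖G x z‖ ≤ M * ((1 + ‖x‖) * (1 + ‖z‖))) {a : ℝ} (ha : a ≠ 0) (b k : ℝ) :
    ∫ x0, ∫ x1, ρ x1 • ((φ (a • x0 + b • x1) * (k * Real.exp (-‖x0‖ ^ 2 / 2))) •
        G (a • x0 + b • x1) x0) =
      ∫ x, φ x • ∫ y, (ρ y * gaussianProfile (|a ^ Module.finrank ℝ V|⁻¹ * k) a (x - b • y)) •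
        G x (a⁻¹ • (x - b • y)) := by
  obtain ⟨hφi, C, hC⟩ := hφs.exists_integrable_bound hφ
  have hM : 0 ≤ M := by simpa using (norm_nonneg _).trans (hGM 0 0)
  rw [integral_integral_comp_smul_add_smul (φ := fun x => |φ x| * (1 + ‖x‖))
    (w := fun z => M * |k| * 2 * Real.exp (-(1 / 4) * ‖z‖ ^ 2)) (Cφ := C) (Cw := M * |k| * 2)
    (H := fun x z => (φ x * (k * Real.exp (-‖z‖ ^ 2 / 2))) • G x z) hρ hφi hC
    ((integrable_exp_neg_mul_sq_norm (by norm_num)).const_mul _) (fun x => by positivity)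
    (fun x => mul_le_of_le_one_right (by positivity) (exp_neg_mul_sq_norm_le_one x))
    (fun x => by positivity) (by fun_prop) ?_ ha]
  · refine integral_congr_ae (.of_forall fun x => ?_)
    simp only [← integral_smul]
    refine integral_congr_ae (.of_forall fun y => ?_)
    simp only [smul_smul, gaussianProfile]
    congr 1
    ring
  · intro x z
    rw [norm_smul, norm_mul, norm_mul, Real.norm_eq_abs, Real.norm_eq_abs, Real.norm_eq_abs,
      Real.abs_exp]
    calc |φ x| * (|k| * Real.exp (-‖z‖ ^ 2 / 2)) * ‖G x z‖
        ≤ |φ x| * (|k| * Real.exp (-‖z‖ ^ 2 / 2)) * (M * ((1 + ‖x‖) * (1 + ‖z‖))) := by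
          gcongr
          exact hGM x z
      _ = |φ x| * (1 + ‖x‖) * (M * |k|) * ((1 + ‖z‖) * Real.exp (-‖z‖ ^ 2 / 2)) := by ring
      _ ≤ |φ x| * (1 + ‖x‖) * (M * |k|) * (2 * Real.exp (-(1 / 4) * ‖z‖ ^ 2)) := by
          exact mul_le_mul_of_nonneg_left (one_add_norm_mul_exp_neg_sq_le z) (by positivity)
      _ = |φ x| * (1 + ‖x‖) * (M * |k| * 2 * Real.exp (-(1 / 4) * ‖z‖ ^ 2)) := by ring

end Gaussian

theorem integral_densMeasure {d : ℕ} {F : Type*} [NormedAddCommGroup F] [NormedSpace ℝ F]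
    {ρ : EuclideanSpace ℝ (Fin d) → ℝ} (hρ : Measurable ρ) (f : EuclideanSpace ℝ (Fin d) → F) :
    ∫ x, f x ∂densMeasure ρ = ∫ x, max (ρ x) 0 • f x := by
  rw [densMeasure, integral_withDensity_eq_integral_toReal_smul hρ.ennreal_ofReal
    (.of_forall fun x => ENNReal.ofReal_lt_top)]
  simp only [ENNReal.toReal_ofReal']

theorem integral_map_prod_densMeasure {d : ℕ} {ρ0 ρ1 φ : EuclideanSpace ℝ (Fin d) → ℝ}
    (hρ0 : Integrable ρ0) (hρ0m : Measurable ρ0) (hρ0nn : ∀ x, 0 ≤ ρ0 x)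
    (hρ1 : Integrable ρ1) (hρ1m : Measurable ρ1) (hρ1nn : ∀ x, 0 ≤ ρ1 x)
    {T : EuclideanSpace ℝ (Fin d) × EuclideanSpace ℝ (Fin d) → EuclideanSpace ℝ (Fin d)}
    (hT : Continuous T) (hφ : Continuous φ) (hφs : HasCompactSupport φ) :
    ∫ x, φ x ∂(Measure.map T ((densMeasure ρ0).prod (densMeasure ρ1))) =
      ∫ x0, ∫ x1, ρ1 x1 • (ρ0 x0 • φ (T (x0, x1))) := by
  have : IsFiniteMeasure (densMeasure ρ0) := isFiniteMeasure_withDensity_ofReal hρ0.2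
  have : IsFiniteMeasure (densMeasure ρ1) := isFiniteMeasure_withDensity_ofReal hρ1.2
  obtain ⟨C, hC⟩ := hφs.exists_bound_of_continuous hφ
  rw [integral_map hT.aemeasurable hφ.aestronglyMeasurable, integral_prod (fun p => φ (T p))
    (.of_bound (hφ.comp hT).aestronglyMeasurable C (.of_forall fun p => hC _)),
    integral_densMeasure hρ0m]
  refine integral_congr_ae (.of_forall fun x0 => ?_)
  simp only [integral_densMeasure hρ1m, max_eq_left (hρ0nn x0), ← integral_smul]
  refine integral_congr_ae (.of_forall fun x1 => ?_)
  simp only [max_eq_left (hρ1nn x1), smul_comm (ρ0 x0)]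

/-- The law of `a x₀ + b x₁`, with `x₀` Gaussian, has as its only continuous density the Gaussian
smoothing of the density of `x₁`. -/
theorem continuous_density_eq_gaussian_smoothing {d : ℕ} {k : ℝ} (hk : 0 < k)
    {ρ ρ1 : EuclideanSpace ℝ (Fin d) → ℝ} (hρ1C : Continuous ρ1) (hρ1nn : ∀ x, 0 ≤ ρ1 x)
    (hρ1m : ∫ x, ρ1 x = 1) (hρC : Continuous ρ) {a : ℝ} (ha : a ≠ 0) (b : ℝ)
    (hρ : Measure.map (fun p : EuclideanSpace ℝ (Fin d) × EuclideanSpace ℝ (Fin d) =>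
        a • p.1 + b • p.2)
      ((densMeasure fun x => k * Real.exp (-‖x‖ ^ 2 / 2)).prod (densMeasure ρ1)) =
        densMeasure ρ) :
    ρ = fun x => ∫ y, ρ1 y • gaussianProfile
      (|a ^ Module.finrank ℝ (EuclideanSpace ℝ (Fin d))|⁻¹ * k) a (x - b • y) := by
  set K := gaussianProfile (V := EuclideanSpace ℝ (Fin d))
    (|a ^ Module.finrank ℝ (EuclideanSpace ℝ (Fin d))|⁻¹ * k) a
  have hρ1 : Integrable ρ1 := .of_integral_ne_zero (by simp [hρ1m])
  have hexp : Integrable fun x : EuclideanSpace ℝ (Fin d) => k * Real.exp (-‖x‖ ^ 2 / 2) := by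
    refine ((integrable_exp_neg_mul_sq_norm (s := 1 / 2) (by norm_num)).const_mul k).congr
      (.of_forall fun x => ?_)
    simp only
    ring_nf
  have hmax : (fun x => max (ρ x) 0) = fun x => ∫ y, ρ1 y • K (x - b • y) := by
    refine Continuous.eq_of_integral_smul_eq (by fun_prop)
      (continuous_integral_smul_comp_sub_smul hρ1 (continuous_gaussianProfile _ a)
        (norm_gaussianProfile_le _ a) b) fun φ hφ hφs => ?_
    have h1 := integral_densMeasure hρC.measurable φ
    rw [← hρ, integral_map_prod_densMeasure hexp (by fun_prop) (fun x => by positivity) hρ1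
      hρ1C.measurable hρ1nn (by fun_prop) hφ hφs] at h1
    have h2 := integral_integral_gaussian_comp (G := fun _ _ => (1 : ℝ)) (M := 1) hρ1 hφ hφs
      (by fun_prop) (fun x z => by
        simp only [norm_one, one_mul]
        nlinarith [norm_nonneg x, norm_nonneg z, mul_nonneg (norm_nonneg x) (norm_nonneg z)])
      ha b k
    simp only [smul_eq_mul, mul_one] at h1 h2 ⊢
    simp only [mul_comm (φ _)] at h2 ⊢
    rw [← h1, h2]
  funext x
  have hx := congrFun hmax x
  have hpos : 0 < ∫ y, ρ1 y • K (x - b • y) :=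
    integral_smul_gaussianProfile_pos hρ1nn hρ1m (by positivity) a b x
  rw [← hx] at hpos ⊢
  exact (max_eq_left (by simpa using hpos : 0 < ρ x).le).symm

/-- For a standard Gaussian base density and a linear interpolant
`I_t = a_t x0 + b_t x1` (with `ȧ ≤ 0 ≤ ḃ` and the stated boundary conditions), for
`t ∈ (0,1)` the current satisfies `j_t(x) = (ḃ/b) x ρ_t(x) - a(ȧ - (ḃ/b)a) ∇ρ_t(x)`, and
hence `v_t(x) = (ḃ/b) x - a(ȧ - (ḃ/b)a) ∇log ρ_t(x)` wherever `ρ_t(x) > 0`. -/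
theorem current_velocity_score_decomposition
    (d : ℕ) (ρ0 ρ1 : EuclideanSpace ℝ (Fin d) → ℝ)
    -- `ρ0` is the standard Gaussian density
    (hρ0 : ∀ x, ρ0 x = (2 * π) ^ (-(d : ℝ) / 2) * Real.exp (-‖x‖ ^ 2 / 2))
    (hρ1nn : ∀ x, 0 ≤ ρ1 x) (hρ1m : ∫ x, ρ1 x = 1) (hρ1C1 : ContDiff ℝ 1 ρ1)
    -- a linear interpolant `I_t(x0,x1) = a_t x0 + b_t x1`
    (a b da db : ℝ → ℝ)
    (ha' : ∀ t, HasDerivAt a (da t) t) (hb' : ∀ t, HasDerivAt b (db t) t)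
    (hdaC : ContinuousOn da (Icc (0:ℝ) 1)) (hdbC : ContinuousOn db (Icc (0:ℝ) 1))
    (ha0 : a 0 = 1) (ha1 : a 1 = 0) (hb0 : b 0 = 0) (hb1 : b 1 = 1)
    (I : ℝ → EuclideanSpace ℝ (Fin d) → EuclideanSpace ℝ (Fin d) → EuclideanSpace ℝ (Fin d))
    (hI : ∀ t x0 x1, I t x0 x1 = a t • x0 + b t • x1)
    (dI : ℝ → EuclideanSpace ℝ (Fin d) → EuclideanSpace ℝ (Fin d) → EuclideanSpace ℝ (Fin d))
    (hdI : ∀ t x0 x1, dI t x0 x1 = da t • x0 + db t • x1)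
    -- `E[|∂_t I_t(x0,x1)|²] < ∞`
    (hdIL2 : (∫⁻ t in Icc (0:ℝ) 1, ∫⁻ x0, ∫⁻ x1,
      ENNReal.ofReal (‖dI t x0 x1‖ ^ 2 * (ρ0 x0 * ρ1 x1))) < ⊤)
    -- absolute integrability of the characteristic function of `x_t`
    (hF1 : ∀ t ∈ Icc (0:ℝ) 1, Integrable fun k : EuclideanSpace ℝ (Fin d) =>
      ∫ x0, ∫ x1, Complex.exp (Complex.I * (⟪k, I t x0 x1⟫ : ℝ)) * (ρ0 x0 : ℂ) * (ρ1 x1 : ℂ))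
    -- absolute integrability of the Fourier transform of the current
    (hF2 : ∀ t ∈ Icc (0:ℝ) 1, Integrable fun k : EuclideanSpace ℝ (Fin d) =>
      ∫ x0, ∫ x1, (fun i => (dI t x0 x1 i : ℂ) *
        Complex.exp (Complex.I * (⟪k, I t x0 x1⟫ : ℝ)) * (ρ0 x0 : ℂ) * (ρ1 x1 : ℂ) :
        Fin d → ℂ))
    -- `ρ_t` is the (continuous) probability density of `x_t = I_t(x0,x1)`
    (ρt : ℝ → EuclideanSpace ℝ (Fin d) → ℝ)
    (hρt : ∀ t ∈ Icc (0:ℝ) 1,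
      Measure.map (fun p : EuclideanSpace ℝ (Fin d) × EuclideanSpace ℝ (Fin d) => I t p.1 p.2)
        ((densMeasure ρ0).prod (densMeasure ρ1)) = densMeasure (ρt t))
    (hρtC : ∀ t ∈ Icc (0:ℝ) 1, Continuous (ρt t))
    -- the (continuous) probability current, defined weakly against test functions
    (j : ℝ → EuclideanSpace ℝ (Fin d) → EuclideanSpace ℝ (Fin d))
    (hj : ∀ t ∈ Icc (0:ℝ) 1, ∀ φ : EuclideanSpace ℝ (Fin d) → ℝ,
      Continuous φ → HasCompactSupport φ →
      ∫ x, φ x • j t x = ∫ x0, ∫ x1, (φ (I t x0 x1) * (ρ0 x0 * ρ1 x1)) • dI t x0 x1)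
    (hjC : ∀ t ∈ Icc (0:ℝ) 1, Continuous (j t))
    -- the velocity field `v = j/ρ` on `{ρ > 0}`, zero elsewhere
    (v : ℝ → EuclideanSpace ℝ (Fin d) → EuclideanSpace ℝ (Fin d))
    (hv : ∀ t x, v t x = if 0 < ρt t x then (ρt t x)⁻¹ • j t x else 0)
    -- monotonicity and positivity of the interpolation coefficients
    (hda : ∀ t ∈ Icc (0:ℝ) 1, da t ≤ 0) (hdb : ∀ t ∈ Icc (0:ℝ) 1, 0 ≤ db t)
    (hapos : ∀ t ∈ Ico (0:ℝ) 1, 0 < a t) (hbpos : ∀ t ∈ Ioc (0:ℝ) 1, 0 < b t) :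
    ∀ t ∈ Ioo (0:ℝ) 1, ∀ x,
      j t x = (db t / b t) • (ρt t x • x) -
        (a t * (da t - db t / b t * a t)) • gradient (ρt t) x ∧
      (0 < ρt t x → v t x = (db t / b t) • x -
        (a t * (da t - db t / b t * a t)) • gradient (fun y => Real.log (ρt t y)) x) := by
  intro t ht x
  have htI : t ∈ Icc (0 : ℝ) 1 := Ioo_subset_Icc_self ht
  have hapos := hapos t ⟨ht.1.le, ht.2⟩
  have hbpos := hbpos t ⟨ht.1, ht.2.le⟩
  set c : ℝ := (2 * π) ^ (-(d : ℝ) / 2)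
  have hc : 0 < c := by positivity
  set k := |a t ^ Module.finrank ℝ (EuclideanSpace ℝ (Fin d))|⁻¹ * c
  set s := db t / b t
  set m := da t - s * a t with hm
  have hρ1 : Integrable ρ1 := .of_integral_ne_zero (by simp [hρ1m])
  have hρ0' : ρ0 = fun x => c * Real.exp (-‖x‖ ^ 2 / 2) := funext hρ0
  have hI' : ∀ p : EuclideanSpace ℝ (Fin d) × EuclideanSpace ℝ (Fin d),
    I t p.1 p.2 = a t • p.1 + b t • p.2 := fun p => hI t p.1 p.2
  have hdens : ρt t = fun x => ∫ y, ρ1 y • gaussianProfile k (a t) (x - b t • y) := by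
    refine continuous_density_eq_gaussian_smoothing hc hρ1C1.continuous hρ1nn hρ1m (hρtC t htI)
      hapos.ne' (b t) ?_
    simpa only [hI', hρ0'] using hρt t htI
  set g' : EuclideanSpace ℝ (Fin d) → EuclideanSpace ℝ (Fin d) :=
    fun x => ∫ y, ρ1 y • gaussianProfileGradient k (a t) (x - b t • y) with hg'
  have hgrad : ∀ x, HasGradientAt (ρt t) (g' x) x := fun x => by
    rw [hdens]
    exact hasGradientAt_integral_smul_comp_sub_smul hρ1 (hasGradientAt_gaussianProfile k (a t))
      (continuous_gaussianProfileGradient k (a t)) (norm_gaussianProfile_le k (a t))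
      (norm_gaussianProfileGradient_le k (a t)) (b t) x
  have hg'C : Continuous g' := continuous_integral_smul_comp_sub_smul hρ1
    (continuous_gaussianProfileGradient k (a t)) (norm_gaussianProfileGradient_le k (a t)) (b t)
  have hρC := hρtC t htI
  have hcurrent : j t = fun x => s • (ρt t x • x) - (a t * m) • g' x := by
    refine Continuous.eq_of_integral_smul_eq (hjC t htI) (by fun_prop) fun φ hφ hφs => ?_
    have hvel : ∀ x0 x1, dI t x0 x1 = s • (a t • x0 + b t • x1) + m • x0 := fun x0 x1 => by
      have hsb : s * b t = db t := div_mul_cancel₀ _ hbpos.ne'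
      rw [hdI, hm, ← hsb]
      module
    have key := integral_integral_gaussian_comp (G := fun x z => s • x + m • z) (M := |s| + |m|)
      hρ1 hφ hφs (by fun_prop) (fun x z => by
        refine (norm_add_le _ _).trans ?_
        rw [norm_smul, norm_smul, Real.norm_eq_abs, Real.norm_eq_abs]
        have hx := norm_nonneg x
        have hz := norm_nonneg z
        have h1 : ‖x‖ ≤ (1 + ‖x‖) * (1 + ‖z‖) := by nlinarith [mul_nonneg hx hz]
        have h2 : ‖z‖ ≤ (1 + ‖x‖) * (1 + ‖z‖) := by nlinarith [mul_nonneg hx hz]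
        rw [add_mul]
        gcongr) hapos.ne' (b t) c
    rw [hj t htI φ hφ hφs]
    calc ∫ x0, ∫ x1, (φ (I t x0 x1) * (ρ0 x0 * ρ1 x1)) • dI t x0 x1 = _ := by
          simp only [hvel, hI, hρ0, smul_smul]
          congr! 5
          ring
      _ = _ := key
      _ = _ := by
        refine integral_congr_ae (.of_forall fun x => ?_)
        simp only
        congr 1
        have hi1 := integrable_smul_comp_sub_smul hρ1 (continuous_gaussianProfile k (a t))
          (norm_gaussianProfile_le k (a t)) (b t) x
        have hi2 := integrable_smul_comp_sub_smul hρ1 (continuous_gaussianProfileGradient k (a t))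
          (norm_gaussianProfileGradient_le k (a t)) (b t) x
        rw [hdens, hg', ← integral_smul_const, ← integral_smul, ← integral_smul]
        refine Eq.trans ?_ (integral_sub ((hi1.smul_const x).smul s) (hi2.smul (a t * m)))
        refine integral_congr_ae (.of_forall fun y => ?_)
        simp only [gaussianProfileGradient]
        generalize (a t)⁻¹ • (x - b t • y) = u
        match_scalars <;> simp [k] <;> field_simp
  have hj' : j t x = s • (ρt t x • x) - (a t * m) • gradient (ρt t) x := by
    rw [hcurrent, (hgrad x).gradient]
  refine ⟨hj', fun hpos => ?_⟩
  have hlog : gradient (fun y => Real.log (ρt t y)) x = (ρt t x)⁻¹ • gradient (ρt t) x := by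
    rw [(hgrad x).gradient]
    refine HasGradientAt.gradient ?_
    rw [hasGradientAt_iff_hasFDerivAt]
    refine ((hgrad x).hasFDerivAt.log hpos.ne').congr_fderiv ?_
    rw [map_smul]
  rw [hv, if_pos hpos, hj', hlog, smul_sub, smul_comm _ s, inv_smul_smul₀ hpos.ne',
    smul_comm (ρt t x)⁻¹ (a t * m)]
end

section
/- Assume ρ0(x) = (2π)^{−d/2} e^{−|x|²/2} is the standard Gaussian density on ℝ^d and the interpolant is linear, I_t(x0,x1) = a_t x0 + b_t x1, with a_t, b_t continuously differentiable on [0,1], ȧ_t ≤ 0, ḃ_t ≥ 0, a_0 = 1, a_1 = 0, b_0 = 0, b_1 = 1, a_t > 0 on [0,1), and b_t > 0 on (0,1]. Then on t ∈ (0,1) the interpolant density satisfies the diffusion equation ∂_t ρ_t(x) + (ḃ_t/b_t) ∇·(x ρ_t(x)) = a_t(ȧ_t − (ḃ_t/b_t) a_t) Δρ_t(x), and the diffusion coefficient is nonpositive: a_t(ȧ_t − (ḃ_t/b_t) a_t) ≤ 0 for all t ∈ (0,1). -/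
open MeasureTheory Real Set
open scoped RealInnerProductSpace ENNReal

/-- The divergence `∇·F = ∑ i ∂_i F_i` of a vector field on `ℝ^d`, given componentwise. -/
noncomputable def divg {d : ℕ} (F : EuclideanSpace ℝ (Fin d) → Fin d → ℝ)
    (x : EuclideanSpace ℝ (Fin d)) : ℝ :=
  ∑ i, fderiv ℝ (fun y => F y i) x (EuclideanSpace.single i 1)

/-- The Laplacian `Δf = ∑ i ∂²_i f` of a scalar field on `ℝ^d`. -/
noncomputable def lap {d : ℕ} (f : EuclideanSpace ℝ (Fin d) → ℝ)
    (x : EuclideanSpace ℝ (Fin d)) : ℝ :=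
  ∑ i, fderiv ℝ (fun y => fderiv ℝ f y (EuclideanSpace.single i 1)) x
    (EuclideanSpace.single i 1)

/-- The density at `z` of the centred Gaussian on `ℝ^d` with covariance `a² Id`. -/
noncomputable def gaussKernel {d : ℕ} (a : ℝ) (z : EuclideanSpace ℝ (Fin d)) : ℝ :=
  (2 * π) ^ (-(d : ℝ) / 2) * (a ^ d)⁻¹ * Real.exp (-‖z‖ ^ 2 / (2 * a ^ 2))

section GaussKernel

variable {d : ℕ}

theorem gaussKernel_pos {a : ℝ} (ha : 0 < a) (z : EuclideanSpace ℝ (Fin d)) :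
    0 < gaussKernel a z := by
  unfold gaussKernel
  positivity

theorem continuous_gaussKernel (a : ℝ) :
    Continuous (gaussKernel a : EuclideanSpace ℝ (Fin d) → ℝ) := by
  unfold gaussKernel
  fun_prop

/-- The Gaussian kernel decays at least like `(1 + ‖z‖²)⁻¹`. -/
theorem gaussKernel_mul_one_add_sq_le {a : ℝ} (ha : 0 < a) (z : EuclideanSpace ℝ (Fin d)) :
    gaussKernel a z * (1 + ‖z‖ ^ 2) ≤
      (2 * π) ^ (-(d : ℝ) / 2) * (a ^ d)⁻¹ * (1 + 2 * a ^ 2) := by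
  have h1 := Real.add_one_le_exp (‖z‖ ^ 2 / (2 * a ^ 2))
  have h2 : Real.exp (-‖z‖ ^ 2 / (2 * a ^ 2)) * Real.exp (‖z‖ ^ 2 / (2 * a ^ 2)) = 1 := by
    rw [← Real.exp_add, neg_div, neg_add_cancel, Real.exp_zero]
  have h3 : 1 + ‖z‖ ^ 2 ≤ (1 + 2 * a ^ 2) * Real.exp (‖z‖ ^ 2 / (2 * a ^ 2)) := by
    have h4 : ‖z‖ ^ 2 = 2 * a ^ 2 * (‖z‖ ^ 2 / (2 * a ^ 2)) := by field_simp
    have h5 : 0 ≤ ‖z‖ ^ 2 / (2 * a ^ 2) := by positivity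
    nlinarith [sq_nonneg a]
  have hC : 0 ≤ (2 * π) ^ (-(d : ℝ) / 2) * (a ^ d)⁻¹ := by positivity
  unfold gaussKernel
  rw [mul_assoc]
  refine mul_le_mul_of_nonneg_left ?_ hC
  calc _ ≤ Real.exp (-‖z‖ ^ 2 / (2 * a ^ 2)) *
        ((1 + 2 * a ^ 2) * Real.exp (‖z‖ ^ 2 / (2 * a ^ 2))) := by gcongr
    _ = _ := by rw [mul_left_comm, h2, mul_one]

theorem gaussKernel_mul_le {a c r : ℝ} (ha : 0 < a) (hc : 0 ≤ c) {z : EuclideanSpace ℝ (Fin d)}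
    (h : r ≤ c * (1 + ‖z‖ ^ 2)) :
    gaussKernel a z * r ≤
      (2 * π) ^ (-(d : ℝ) / 2) * (a ^ d)⁻¹ * (1 + 2 * a ^ 2) * c := by
  calc gaussKernel a z * r ≤ gaussKernel a z * (c * (1 + ‖z‖ ^ 2)) :=
        mul_le_mul_of_nonneg_left h (gaussKernel_pos ha z).le
    _ = gaussKernel a z * (1 + ‖z‖ ^ 2) * c := by ring
    _ ≤ _ := mul_le_mul_of_nonneg_right (gaussKernel_mul_one_add_sq_le ha z) hc

theorem hasFDerivAt_gaussKernel (a : ℝ) (z : EuclideanSpace ℝ (Fin d)) :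
    HasFDerivAt (gaussKernel a) (-(gaussKernel a z / a ^ 2) • innerSL ℝ z) z := by
  have h := (((hasStrictFDerivAt_norm_sq z).hasFDerivAt.neg.mul_const
    (2 * a ^ 2)⁻¹).exp).const_mul ((2 * π) ^ (-(d : ℝ) / 2) * (a ^ d)⁻¹)
  refine (h.congr_fderiv ?_)
  ext v
  simp [gaussKernel, div_eq_mul_inv]
  ring

theorem hasFDerivAt_gaussKernel_mul_inner {a : ℝ} (ha : 0 < a) (v z : EuclideanSpace ℝ (Fin d)) :
    HasFDerivAt (fun z => -(gaussKernel a z / a ^ 2) * ⟪z, v⟫)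
      ((gaussKernel a z / a ^ 4 * ⟪z, v⟫) • innerSL ℝ z -
        (gaussKernel a z / a ^ 2) • innerSL ℝ v) z := by
  have h := ((hasFDerivAt_gaussKernel a z).mul_const (-(a ^ 2)⁻¹)).mul
    ((innerSL ℝ v).hasFDerivAt (x := z))
  refine (h.congr_fderiv ?_).congr_of_eventuallyEq (.of_forall fun y => ?_)
  · ext w
    simp [real_inner_comm v z]
    field_simp
    ring
  · simp only [Pi.mul_apply, innerSL_apply_apply, real_inner_comm v y]
    ring

/-- Differentiation under the integral sign for `x ↦ ∫ ψ (x - b • y) ∂μ y`. -/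
theorem hasFDerivAt_integral_comp_sub_smul (μ : Measure (EuclideanSpace ℝ (Fin d)))
    [IsFiniteMeasure μ] {ψ : EuclideanSpace ℝ (Fin d) → ℝ}
    {ψ' : EuclideanSpace ℝ (Fin d) → EuclideanSpace ℝ (Fin d) →L[ℝ] ℝ} {M M' : ℝ}
    (hψ : ∀ z, HasFDerivAt ψ (ψ' z) z) (hψ' : Continuous ψ')
    (hM : ∀ z, ‖ψ z‖ ≤ M) (hM' : ∀ z, ‖ψ' z‖ ≤ M') (b : ℝ) (x : EuclideanSpace ℝ (Fin d)) :
    HasFDerivAt (fun x => ∫ y, ψ (x - b • y) ∂μ) (∫ y, ψ' (x - b • y) ∂μ) x := by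
  have hc : Continuous ψ := continuous_iff_continuousAt.2 fun z => (hψ z).continuousAt
  refine hasFDerivAt_integral_of_dominated_of_fderiv_le (bound := fun _ => M')
    (F' := fun x y => ψ' (x - b • y)) Filter.univ_mem ?_ ?_ ?_ ?_ (integrable_const _) ?_
  · exact .of_forall fun x => (hc.comp (by fun_prop)).aestronglyMeasurable
  · exact .of_bound (hc.comp (by fun_prop)).aestronglyMeasurable M (.of_forall fun y => hM _)
  · exact (hψ'.comp (by fun_prop)).aestronglyMeasurable
  · exact .of_forall fun y x _ => hM' _
  · exact .of_forall fun y x _ => (hψ _).comp x ((hasFDerivAt_id x).sub_const _)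

variable (μ : Measure (EuclideanSpace ℝ (Fin d))) [IsFiniteMeasure μ]

theorem integrable_gaussKernel_mul {a c : ℝ} (ha : 0 < a) (hc : 0 ≤ c) (b : ℝ)
    (x : EuclideanSpace ℝ (Fin d)) {g : EuclideanSpace ℝ (Fin d) → ℝ} (hg : Continuous g)
    (hgc : ∀ z, |g z| ≤ c * (1 + ‖z‖ ^ 2)) :
    Integrable (fun y => gaussKernel a (x - b • y) * g (x - b • y)) μ := by
  refine .of_bound (((continuous_gaussKernel a).mul hg).comp
    (by fun_prop : Continuous fun y => x - b • y)).aestronglyMeasurable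
    ((2 * π) ^ (-(d : ℝ) / 2) * (a ^ d)⁻¹ * (1 + 2 * a ^ 2) * c) (.of_forall fun y => ?_)
  rw [norm_mul, Real.norm_of_nonneg (gaussKernel_pos ha _).le]
  exact gaussKernel_mul_le ha hc (hgc _)

theorem integrable_gaussKernel {a : ℝ} (ha : 0 < a) (b : ℝ) (x : EuclideanSpace ℝ (Fin d)) :
    Integrable (fun y => gaussKernel a (x - b • y)) μ := by
  simpa using integrable_gaussKernel_mul μ ha zero_le_one b x (g := fun _ => 1)
    continuous_const fun z => by simp

theorem abs_inner_le_mul_one_add_sq (z v : EuclideanSpace ℝ (Fin d)) :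
    |⟪z, v⟫| ≤ ‖v‖ * (1 + ‖z‖ ^ 2) := by
  have h1 := abs_real_inner_le_norm z v
  have h2 : ‖z‖ ≤ 1 + ‖z‖ ^ 2 := by nlinarith [sq_nonneg (‖z‖ - 1), norm_nonneg z]
  nlinarith [norm_nonneg v]

theorem integrable_gaussKernel_mul_inner {a : ℝ} (ha : 0 < a) (b : ℝ)
    (x v : EuclideanSpace ℝ (Fin d)) :
    Integrable (fun y => gaussKernel a (x - b • y) * ⟪x - b • y, v⟫) μ :=
  integrable_gaussKernel_mul μ ha (norm_nonneg v) b x (g := fun z => ⟪z, v⟫) (by fun_prop)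
    fun z => abs_inner_le_mul_one_add_sq z v

theorem integrable_gaussKernel_mul_norm_sq {a : ℝ} (ha : 0 < a) (b : ℝ)
    (x : EuclideanSpace ℝ (Fin d)) :
    Integrable (fun y => gaussKernel a (x - b • y) * ‖x - b • y‖ ^ 2) μ :=
  integrable_gaussKernel_mul μ ha zero_le_one b x (g := fun z => ‖z‖ ^ 2) (by fun_prop)
    fun z => by simp

theorem integrable_gaussKernel_mul_coord_sq {a : ℝ} (ha : 0 < a) (b : ℝ)
    (x : EuclideanSpace ℝ (Fin d)) (i : Fin d) :
    Integrable (fun y => gaussKernel a (x - b • y) * (x - b • y) i ^ 2) μ :=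
  integrable_gaussKernel_mul μ ha zero_le_one b x (g := fun z => z i ^ 2) (by fun_prop)
    fun z => by
      have h := sq_le_sq.2 (by simpa using PiLp.norm_apply_le z i : |z i| ≤ |‖z‖|)
      rw [abs_of_nonneg (sq_nonneg _)]
      linarith

/-- The first derivative in space of a Gaussian mixture. -/
theorem fderiv_integral_gaussKernel {a : ℝ} (ha : 0 < a) (b : ℝ)
    (x : EuclideanSpace ℝ (Fin d)) :
    DifferentiableAt ℝ (fun x => ∫ y, gaussKernel a (x - b • y) ∂μ) x ∧
      ∀ v, fderiv ℝ (fun x => ∫ y, gaussKernel a (x - b • y) ∂μ) x v =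
        ∫ y, -(gaussKernel a (x - b • y) / a ^ 2) * ⟪x - b • y, v⟫ ∂μ := by
  have hcont := continuous_gaussKernel (d := d) a
  have hc : Continuous fun z : EuclideanSpace ℝ (Fin d) =>
      -(gaussKernel a z / a ^ 2) • innerSL ℝ z := by fun_prop
  have hbd : ∀ z : EuclideanSpace ℝ (Fin d), ‖-(gaussKernel a z / a ^ 2) • innerSL ℝ z‖ ≤
      (2 * π) ^ (-(d : ℝ) / 2) * (a ^ d)⁻¹ * (1 + 2 * a ^ 2) * (1 / a ^ 2) := fun z => by
    rw [norm_smul, norm_neg, norm_div, Real.norm_of_nonneg (gaussKernel_pos ha z).le,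
      innerSL_apply_norm, Real.norm_of_nonneg (sq_nonneg a), div_mul_eq_mul_div,
      mul_div_assoc]
    refine gaussKernel_mul_le ha (by positivity) ?_
    rw [div_eq_inv_mul, one_div]
    gcongr
    nlinarith [sq_nonneg (‖z‖ - 1), norm_nonneg z]
  have h := hasFDerivAt_integral_comp_sub_smul μ (hasFDerivAt_gaussKernel (d := d) a) hc
    (fun z => by
      simpa [abs_of_pos (gaussKernel_pos ha z)] using gaussKernel_mul_le (r := 1) ha
        zero_le_one (z := z) (by simp)) hbd b x
  refine ⟨h.differentiableAt, fun v => ?_⟩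
  rw [h.fderiv, ContinuousLinearMap.integral_apply]
  · simp only [neg_smul, neg_apply, smul_apply, innerSL_apply_apply, smul_eq_mul, neg_mul]
  · exact .of_bound (hc.comp (by fun_prop)).aestronglyMeasurable _ (.of_forall fun y => hbd _)

/-- The second derivative in space of a Gaussian mixture. -/
theorem fderiv_fderiv_integral_gaussKernel {a : ℝ} (ha : 0 < a) (b : ℝ)
    (x v w : EuclideanSpace ℝ (Fin d)) :
    fderiv ℝ (fun x => fderiv ℝ (fun x => ∫ y, gaussKernel a (x - b • y) ∂μ) x v) x w =
      ∫ y, (gaussKernel a (x - b • y) / a ^ 4 * ⟪x - b • y, v⟫ * ⟪x - b • y, w⟫ -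
        gaussKernel a (x - b • y) / a ^ 2 * ⟪v, w⟫) ∂μ := by
  have hcont := continuous_gaussKernel (d := d) a
  have hc : Continuous fun z : EuclideanSpace ℝ (Fin d) =>
      (gaussKernel a z / a ^ 4 * ⟪z, v⟫) • innerSL ℝ z -
        (gaussKernel a z / a ^ 2) • innerSL ℝ v := by fun_prop
  have hbd : ∀ z : EuclideanSpace ℝ (Fin d),
      ‖(gaussKernel a z / a ^ 4 * ⟪z, v⟫) • innerSL ℝ z -
        (gaussKernel a z / a ^ 2) • innerSL ℝ v‖ ≤
      (2 * π) ^ (-(d : ℝ) / 2) * (a ^ d)⁻¹ * (1 + 2 * a ^ 2) *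
        (‖v‖ / a ^ 4 + ‖v‖ / a ^ 2) := fun z => by
    refine (norm_sub_le _ _).trans ?_
    simp only [norm_smul, norm_mul, norm_div, innerSL_apply_norm, norm_pow,
      Real.norm_of_nonneg (gaussKernel_pos ha z).le, Real.norm_of_nonneg ha.le]
    have hi : ‖⟪z, v⟫‖ ≤ ‖z‖ * ‖v‖ := norm_inner_le_norm z v
    have hK := gaussKernel_pos ha z
    refine le_trans ?_ (gaussKernel_mul_le (z := z) ha (by positivity) le_rfl)
    calc gaussKernel a z / a ^ 4 * ‖⟪z, v⟫‖ * ‖z‖ + gaussKernel a z / a ^ 2 * ‖v‖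
        ≤ gaussKernel a z / a ^ 4 * (‖z‖ * ‖v‖) * ‖z‖ + gaussKernel a z / a ^ 2 * ‖v‖ := by
          gcongr
      _ = gaussKernel a z * (‖v‖ / a ^ 4 * ‖z‖ ^ 2 + ‖v‖ / a ^ 2 * 1) := by ring
      _ ≤ gaussKernel a z * (‖v‖ / a ^ 4 * (1 + ‖z‖ ^ 2) + ‖v‖ / a ^ 2 * (1 + ‖z‖ ^ 2)) := by
          gcongr
          · linarith
          · linarith [sq_nonneg ‖z‖]
      _ = _ := by ring
  have hψ : ∀ z : EuclideanSpace ℝ (Fin d), ‖-(gaussKernel a z / a ^ 2) * ⟪z, v⟫‖ ≤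
      (2 * π) ^ (-(d : ℝ) / 2) * (a ^ d)⁻¹ * (1 + 2 * a ^ 2) * (‖v‖ / a ^ 2) := fun z => by
    rw [norm_mul, norm_neg, norm_div, Real.norm_of_nonneg (gaussKernel_pos ha z).le,
      Real.norm_of_nonneg (sq_nonneg a), div_mul_eq_mul_div, mul_div_assoc]
    refine gaussKernel_mul_le ha (by positivity) ?_
    rw [div_mul_eq_mul_div]
    gcongr
    exact abs_inner_le_mul_one_add_sq z v
  have h := hasFDerivAt_integral_comp_sub_smul μ
    (hasFDerivAt_gaussKernel_mul_inner (d := d) ha v) hc hψ hbd b x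
  simp_rw [fun x => (fderiv_integral_gaussKernel μ ha b x).2 v]
  rw [h.fderiv, ContinuousLinearMap.integral_apply]
  · simp only [sub_apply, smul_apply, innerSL_apply_apply, smul_eq_mul]
  · exact .of_bound (hc.comp (by fun_prop)).aestronglyMeasurable _ (.of_forall fun y => hbd _)

theorem divg_integral_gaussKernel {a : ℝ} (ha : 0 < a) (b : ℝ)
    (x : EuclideanSpace ℝ (Fin d)) :
    divg (fun x i => (∫ y, gaussKernel a (x - b • y) ∂μ) * x i) x =
      d * (∫ y, gaussKernel a (x - b • y) ∂μ) -
        (∫ y, gaussKernel a (x - b • y) * ⟪x - b • y, x⟫ ∂μ) / a ^ 2 := by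
  obtain ⟨hd, hv⟩ := fderiv_integral_gaussKernel μ ha b x
  have hi : ∀ i, fderiv ℝ (fun x => (∫ y, gaussKernel a (x - b • y) ∂μ) * x i) x
      (EuclideanSpace.single i 1) = (∫ y, gaussKernel a (x - b • y) ∂μ) +
        x i * fderiv ℝ (fun x => ∫ y, gaussKernel a (x - b • y) ∂μ) x
          (EuclideanSpace.single i 1) := fun i => by
    have hp : HasFDerivAt (fun x : EuclideanSpace ℝ (Fin d) => x i)
        (EuclideanSpace.proj i : EuclideanSpace ℝ (Fin d) →L[ℝ] ℝ) x :=
      (EuclideanSpace.proj i : EuclideanSpace ℝ (Fin d) →L[ℝ] ℝ).hasFDerivAt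
    rw [(hd.hasFDerivAt.fun_mul hp).fderiv]
    simp
  have hx : ∑ i, x i • EuclideanSpace.single i (1 : ℝ) = x := by
    ext j
    simp [Finset.sum_apply, Pi.single_apply]
  unfold divg
  simp_rw [hi, Finset.sum_add_distrib, ← smul_eq_mul (x _), ← map_smul, ← map_sum, hx, hv]
  simp only [Finset.sum_const, Finset.card_univ, Fintype.card_fin, nsmul_eq_mul]
  rw [sub_eq_add_neg, ← integral_div, ← integral_neg]
  congr 2
  ext y
  ring

theorem lap_integral_gaussKernel {a : ℝ} (ha : 0 < a) (b : ℝ)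
    (x : EuclideanSpace ℝ (Fin d)) :
    lap (fun x => ∫ y, gaussKernel a (x - b • y) ∂μ) x =
      (∫ y, gaussKernel a (x - b • y) * ‖x - b • y‖ ^ 2 ∂μ) / a ^ 4 -
        d * (∫ y, gaussKernel a (x - b • y) ∂μ) / a ^ 2 := by
  unfold lap
  have hi : ∀ i : Fin d, fderiv ℝ (fun y => fderiv ℝ
      (fun x => ∫ y, gaussKernel a (x - b • y) ∂μ) y (EuclideanSpace.single i 1)) x
        (EuclideanSpace.single i 1) =
      (∫ y, gaussKernel a (x - b • y) * (x - b • y) i ^ 2 ∂μ) / a ^ 4 -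
        (∫ y, gaussKernel a (x - b • y) ∂μ) / a ^ 2 := fun i => by
    rw [fderiv_fderiv_integral_gaussKernel μ ha, ← integral_div, ← integral_div,
      ← integral_sub ((integrable_gaussKernel_mul_coord_sq μ ha b x i).div_const _)
        ((integrable_gaussKernel μ ha b x).div_const _)]
    congr 1
    ext y
    simp [EuclideanSpace.inner_single_right]
    ring
  simp_rw [hi, Finset.sum_sub_distrib, ← Finset.sum_div]
  rw [← integral_finsetSum _ fun i _ => integrable_gaussKernel_mul_coord_sq μ ha b x i]
  simp_rw [← Finset.mul_sum, EuclideanSpace.real_norm_sq_eq]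
  simp

end GaussKernel

theorem hasDerivAt_gaussKernel_comp {d : ℕ} {a b : ℝ → ℝ} {a' b' s : ℝ}
    (ha : HasDerivAt a a' s) (hb : HasDerivAt b b' s) (has : 0 < a s) (hbs : 0 < b s)
    (x y : EuclideanSpace ℝ (Fin d)) :
    HasDerivAt (fun s => gaussKernel (a s) (x - b s • y))
      (gaussKernel (a s) (x - b s • y) *
        (-(d * a' / a s) + a' / a s ^ 3 * ‖x - b s • y‖ ^ 2 +
          b' / b s / a s ^ 2 * (⟪x - b s • y, x⟫ - ‖x - b s • y‖ ^ 2))) s := by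
  have hz : HasDerivAt (fun s => x - b s • y) (-(b' • y)) s :=
    (hb.smul_const y).const_sub x
  have hpow : HasDerivAt (fun s => (a s ^ d)⁻¹) ((a s ^ d)⁻¹ * -(d * a' / a s)) s := by
    refine ((ha.fun_pow d).fun_inv (pow_pos has d).ne').congr_deriv ?_
    rcases d with _ | d
    · simp
    · simp only [Nat.add_sub_cancel]
      field_simp
      ring
  have hsq : HasDerivAt (fun s => 2 * a s ^ 2) (4 * a s * a') s := by
    refine ((ha.fun_pow 2).const_mul 2).congr_deriv ?_
    simp
    ring
  have hin : b' * ⟪x - b s • y, y⟫ =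
      b' / b s * (⟪x - b s • y, x⟫ - ‖x - b s • y‖ ^ 2) := by
    rw [← real_inner_self_eq_norm_sq, ← inner_sub_right, sub_sub_cancel, inner_smul_right]
    field_simp
  have h := ((hpow.const_mul ((2 * π) ^ (-(d : ℝ) / 2)))).fun_mul
    ((hz.norm_sq.fun_neg.fun_div hsq (by positivity)).exp)
  refine h.congr_deriv ?_
  rw [inner_neg_right, inner_smul_right, hin]
  unfold gaussKernel
  field_simp
  ring

/-- The derivative in time of a Gaussian mixture. -/
theorem hasDerivAt_integral_gaussKernel {d : ℕ} (μ : Measure (EuclideanSpace ℝ (Fin d)))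
    [IsFiniteMeasure μ] {a b da db : ℝ → ℝ} {U : Set ℝ} (hU : IsOpen U)
    (ha : ∀ s ∈ U, HasDerivAt a (da s) s) (hb : ∀ s ∈ U, HasDerivAt b (db s) s)
    (hda : ContinuousOn da U) (hdb : ContinuousOn db U)
    (hapos : ∀ s ∈ U, 0 < a s) (hbpos : ∀ s ∈ U, 0 < b s) {t : ℝ} (ht : t ∈ U)
    (x : EuclideanSpace ℝ (Fin d)) :
    HasDerivAt (fun s => ∫ y, gaussKernel (a s) (x - b s • y) ∂μ)
      (-(d * da t / a t) * (∫ y, gaussKernel (a t) (x - b t • y) ∂μ) +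
        da t / a t ^ 3 * (∫ y, gaussKernel (a t) (x - b t • y) * ‖x - b t • y‖ ^ 2 ∂μ) +
        db t / b t / a t ^ 2 *
          ((∫ y, gaussKernel (a t) (x - b t • y) * ⟪x - b t • y, x⟫ ∂μ) -
            (∫ y, gaussKernel (a t) (x - b t • y) * ‖x - b t • y‖ ^ 2 ∂μ))) t := by
  set B : ℝ → ℝ := fun s => (2 * π) ^ (-(d : ℝ) / 2) * (a s ^ d)⁻¹ * (1 + 2 * a s ^ 2) *
    (|d * da s / a s| + |da s / a s ^ 3| + |db s / b s / a s ^ 2| * (‖x‖ + 1))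
  have hUt : U ∈ nhds t := hU.mem_nhds ht
  have hBc : ContinuousAt B t := by
    have h1 := (ha t ht).continuousAt
    have h2 := (hb t ht).continuousAt
    have h3 := hda.continuousAt hUt
    have h4 := hdb.continuousAt hUt
    have h5 := (hapos t ht).ne'
    have h6 := (hbpos t ht).ne'
    have h7 : a t ^ d ≠ 0 := pow_ne_zero _ h5
    have h8 : a t ^ 2 ≠ 0 := pow_ne_zero _ h5
    have h9 : a t ^ 3 ≠ 0 := pow_ne_zero _ h5
    fun_prop (disch := assumption)
  have hBt : ∀ᶠ s in nhds t, B s < B t + 1 := hBc.eventually_lt_const (lt_add_one _)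
  have hcont := fun s => continuous_gaussKernel (d := d) (a s)
  have h := hasDerivAt_integral_of_dominated_loc_of_deriv_le (μ := μ)
    (F := fun s y => gaussKernel (a s) (x - b s • y)) (bound := fun _ => B t + 1)
    (Filter.inter_mem hUt hBt)
    (.of_forall fun s => ((hcont s).comp (by fun_prop)).aestronglyMeasurable)
    (integrable_gaussKernel μ (hapos t ht) (b t) x)
    (F' := fun s y => gaussKernel (a s) (x - b s • y) *
        (-(d * da s / a s) + da s / a s ^ 3 * ‖x - b s • y‖ ^ 2 +
          db s / b s / a s ^ 2 * (⟪x - b s • y, x⟫ - ‖x - b s • y‖ ^ 2)))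
    (by
      have := hcont t
      exact Continuous.aestronglyMeasurable (by fun_prop))
    (.of_forall fun y s hs => by
      refine le_trans ?_ hs.2.le
      have hpos := hapos s hs.1
      rw [norm_mul, Real.norm_of_nonneg (gaussKernel_pos hpos _).le]
      refine gaussKernel_mul_le hpos (by positivity) ?_
      generalize x - b s • y = z
      refine (norm_add₃_le).trans ?_
      simp only [Real.norm_eq_abs, abs_mul, abs_neg]
      have h1 : |⟪z, x⟫ - ‖z‖ ^ 2| ≤ (‖x‖ + 1) * (1 + ‖z‖ ^ 2) := by
        refine (abs_sub _ _).trans ?_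
        rw [abs_of_nonneg (sq_nonneg ‖z‖)]
        linarith [abs_inner_le_mul_one_add_sq z x]
      have h2 : |‖z‖ ^ 2| ≤ 1 + ‖z‖ ^ 2 := by
        rw [abs_of_nonneg (sq_nonneg ‖z‖)]
        linarith
      have h3 : |d * da s / a s| ≤ |d * da s / a s| * (1 + ‖z‖ ^ 2) :=
        le_mul_of_one_le_right (abs_nonneg _) (by linarith [sq_nonneg ‖z‖])
      have h4 := mul_le_mul_of_nonneg_left h1 (abs_nonneg (db s / b s / a s ^ 2))
      have h5 := mul_le_mul_of_nonneg_left h2 (abs_nonneg (da s / a s ^ 3))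
      linarith)
    (integrable_const _)
    (.of_forall fun y s hs =>
      hasDerivAt_gaussKernel_comp (ha s hs.1) (hb s hs.1) (hapos s hs.1) (hbpos s hs.1) x y)
  refine h.2.congr_deriv ?_
  have i0 := integrable_gaussKernel μ (hapos t ht) (b t) x
  have i1 := integrable_gaussKernel_mul_inner μ (hapos t ht) (b t) x x
  have i2 := integrable_gaussKernel_mul_norm_sq μ (hapos t ht) (b t) x
  rw [← integral_sub i1 i2, ← integral_const_mul, ← integral_const_mul, ← integral_const_mul,
    ← integral_add (i0.const_mul _) (i2.const_mul _)]
  refine Eq.trans ?_ (integral_add ((i0.const_mul _).add (i2.const_mul _))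
    ((i1.sub i2).const_mul _))
  congr 1
  ext y
  ring

theorem lintegral_comp_smul_add {d : ℕ} {a : ℝ} (ha : 0 < a) (c : EuclideanSpace ℝ (Fin d))
    {f : EuclideanSpace ℝ (Fin d) → ℝ≥0∞} (hf : Measurable f) :
    ∫⁻ x, f (a • x + c) = ENNReal.ofReal (a ^ d)⁻¹ * ∫⁻ x, f x := by
  have h := lintegral_map (μ := volume) (hf.comp (measurable_add_const c))
    (measurable_const_smul a)
  rw [Measure.map_addHaar_smul _ ha.ne', lintegral_smul_measure] at h
  simp only [Function.comp_apply, lintegral_add_right_eq_self f c, finrank_euclideanSpace,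
    Fintype.card_fin, smul_eq_mul] at h
  rw [← h, abs_of_nonneg (by positivity)]

/-- If `x₀` is standard Gaussian and `x₁ ~ μ` is independent of it, then `a x₀ + b x₁` has the
Gaussian mixture density. -/
theorem map_gaussian_prod {d : ℕ} (μ : Measure (EuclideanSpace ℝ (Fin d)))
    [IsFiniteMeasure μ] {a : ℝ} (ha : 0 < a) (b : ℝ) :
    Measure.map (fun p : EuclideanSpace ℝ (Fin d) × EuclideanSpace ℝ (Fin d) =>
        a • p.1 + b • p.2) ((densMeasure (gaussKernel 1)).prod μ) =
      densMeasure fun x => ∫ y, gaussKernel a (x - b • y) ∂μ := by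
  have hm : Measurable fun p : EuclideanSpace ℝ (Fin d) × EuclideanSpace ℝ (Fin d) =>
      a • p.1 + b • p.2 := by fun_prop
  have hK : ∀ a : ℝ, Measurable (gaussKernel a : EuclideanSpace ℝ (Fin d) → ℝ) :=
    fun a => (continuous_gaussKernel a).measurable
  have : SFinite (densMeasure (gaussKernel 1 : EuclideanSpace ℝ (Fin d) → ℝ)) := by
    unfold densMeasure
    infer_instance
  have hscale : ∀ z : EuclideanSpace ℝ (Fin d),
      (a ^ d)⁻¹ * gaussKernel 1 (a⁻¹ • z) = gaussKernel a z := fun z => by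
    simp only [gaussKernel, norm_smul, norm_inv, Real.norm_of_nonneg ha.le, one_pow, inv_one,
      mul_one]
    rw [show -(a⁻¹ * ‖z‖) ^ 2 / 2 = -‖z‖ ^ 2 / (2 * a ^ 2) by field_simp]
    ring
  have hdens : ∀ x : EuclideanSpace ℝ (Fin d),
      ENNReal.ofReal (∫ y, gaussKernel a (x - b • y) ∂μ) =
        ∫⁻ y, ENNReal.ofReal (gaussKernel a (x - b • y)) ∂μ := fun x =>
    ofReal_integral_eq_lintegral_ofReal (integrable_gaussKernel μ ha b x)
      (.of_forall fun y => (gaussKernel_pos ha _).le)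
  ext s hs
  have hind : Measurable (s.indicator (1 : EuclideanSpace ℝ (Fin d) → ℝ≥0∞)) :=
    measurable_one.indicator hs
  rw [← lintegral_indicator_one hs, lintegral_map hind hm,
    lintegral_prod_symm' (fun p : EuclideanSpace ℝ (Fin d) × EuclideanSpace ℝ (Fin d) =>
      s.indicator 1 (a • p.1 + b • p.2)) (hind.comp hm)]
  have hinner : ∀ y : EuclideanSpace ℝ (Fin d),
      ∫⁻ x, s.indicator 1 (a • x + b • y) ∂(densMeasure (gaussKernel 1)) =
        ∫⁻ x, ENNReal.ofReal (gaussKernel a (x - b • y)) * s.indicator 1 x := fun y => by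
    have hmy : Measurable fun x => s.indicator (1 : EuclideanSpace ℝ (Fin d) → ℝ≥0∞)
        (a • x + b • y) := hind.comp (by fun_prop)
    unfold densMeasure
    rw [lintegral_withDensity_eq_lintegral_mul _ (hK 1).ennreal_ofReal hmy]
    have hf : Measurable fun x => ENNReal.ofReal (gaussKernel 1 (a⁻¹ • (x - b • y))) *
        s.indicator (1 : EuclideanSpace ℝ (Fin d) → ℝ≥0∞) x :=
      ((hK 1).comp (by fun_prop)).ennreal_ofReal.mul hind
    have h := lintegral_comp_smul_add ha (b • y) hf
    simp only [add_sub_cancel_right, inv_smul_smul₀ ha.ne'] at h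
    simp only [Pi.mul_apply]
    rw [h, ← lintegral_const_mul _ hf]
    simp only [← mul_assoc, ← hscale,
      ENNReal.ofReal_mul (inv_nonneg.2 (pow_nonneg ha.le d))]
  simp only [hinner]
  have hjoint : Measurable fun p : EuclideanSpace ℝ (Fin d) × EuclideanSpace ℝ (Fin d) =>
      ENNReal.ofReal (gaussKernel a (p.2 - b • p.1)) :=
    ((hK a).comp (by fun_prop)).ennreal_ofReal
  rw [lintegral_lintegral_swap (hjoint.mul (hind.comp measurable_snd)).aemeasurable]
  unfold densMeasure
  rw [withDensity_apply _ hs, ← lintegral_indicator hs]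
  congr 1
  ext x
  have hx : Measurable fun y => ENNReal.ofReal (gaussKernel a (x - b • y)) :=
    ((hK a).comp (by fun_prop)).ennreal_ofReal
  rw [lintegral_mul_const _ hx]
  by_cases hx : x ∈ s <;> simp [hx, hdens]

/-- A continuous function is determined by the measure it is a density of, provided that measure
has a positive continuous density. -/
theorem eq_of_densMeasure_eq {d : ℕ} {f g : EuclideanSpace ℝ (Fin d) → ℝ}
    (hf : Continuous f) (hg : Continuous g) (hpos : ∀ x, 0 < g x)
    (h : densMeasure f = densMeasure g) : f = g := by
  have hae := (withDensity_eq_iff_of_sigmaFinite hf.measurable.ennreal_ofReal.aemeasurable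
    hg.measurable.ennreal_ofReal.aemeasurable).1 h
  refine (Continuous.ae_eq_iff_eq volume hf hg).1 (hae.mono fun x hx => ?_)
  have hfx : 0 < f x := ENNReal.ofReal_pos.1 ((ENNReal.ofReal_pos.2 (hpos x)).trans_eq hx.symm)
  exact (ENNReal.ofReal_eq_ofReal_iff hfx.le (hpos x).le).1 hx

/-- For a standard Gaussian base density and a linear interpolant, the
interpolant density satisfies on `(0,1)` the diffusion equation
`∂_t ρ_t + (ḃ/b) ∇·(x ρ_t) = a(ȧ - (ḃ/b)a) Δρ_t`, whose diffusion coefficient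
`a(ȧ - (ḃ/b)a)` is nonpositive. -/
theorem interpolant_density_diffusion_equation
    (d : ℕ) (ρ0 ρ1 : EuclideanSpace ℝ (Fin d) → ℝ)
    -- `ρ0` is the standard Gaussian density
    (hρ0 : ∀ x, ρ0 x = (2 * π) ^ (-(d : ℝ) / 2) * Real.exp (-‖x‖ ^ 2 / 2))
    (hρ1nn : ∀ x, 0 ≤ ρ1 x) (hρ1m : ∫ x, ρ1 x = 1) (hρ1C1 : ContDiff ℝ 1 ρ1)
    -- a linear interpolant `I_t(x0,x1) = a_t x0 + b_t x1`
    (a b da db : ℝ → ℝ)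
    (ha' : ∀ t, HasDerivAt a (da t) t) (hb' : ∀ t, HasDerivAt b (db t) t)
    (hdaC : ContinuousOn da (Icc (0:ℝ) 1)) (hdbC : ContinuousOn db (Icc (0:ℝ) 1))
    (ha0 : a 0 = 1) (ha1 : a 1 = 0) (hb0 : b 0 = 0) (hb1 : b 1 = 1)
    (I : ℝ → EuclideanSpace ℝ (Fin d) → EuclideanSpace ℝ (Fin d) → EuclideanSpace ℝ (Fin d))
    (hI : ∀ t x0 x1, I t x0 x1 = a t • x0 + b t • x1)
    (dI : ℝ → EuclideanSpace ℝ (Fin d) → EuclideanSpace ℝ (Fin d) → EuclideanSpace ℝ (Fin d))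
    (hdI : ∀ t x0 x1, dI t x0 x1 = da t • x0 + db t • x1)
    -- `E[|∂_t I_t(x0,x1)|²] < ∞`
    (hdIL2 : (∫⁻ t in Icc (0:ℝ) 1, ∫⁻ x0, ∫⁻ x1,
      ENNReal.ofReal (‖dI t x0 x1‖ ^ 2 * (ρ0 x0 * ρ1 x1))) < ⊤)
    -- absolute integrability of the characteristic function of `x_t`
    (hF1 : ∀ t ∈ Icc (0:ℝ) 1, Integrable fun k : EuclideanSpace ℝ (Fin d) =>
      ∫ x0, ∫ x1, Complex.exp (Complex.I * (⟪k, I t x0 x1⟫ : ℝ)) * (ρ0 x0 : ℂ) * (ρ1 x1 : ℂ))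
    -- absolute integrability of the Fourier transform of the current
    (hF2 : ∀ t ∈ Icc (0:ℝ) 1, Integrable fun k : EuclideanSpace ℝ (Fin d) =>
      ∫ x0, ∫ x1, (fun i => (dI t x0 x1 i : ℂ) *
        Complex.exp (Complex.I * (⟪k, I t x0 x1⟫ : ℝ)) * (ρ0 x0 : ℂ) * (ρ1 x1 : ℂ) :
        Fin d → ℂ))
    -- `ρ_t` is the (continuous) probability density of `x_t = I_t(x0,x1)`
    (ρt : ℝ → EuclideanSpace ℝ (Fin d) → ℝ)
    (hρt : ∀ t ∈ Icc (0:ℝ) 1,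
      Measure.map (fun p : EuclideanSpace ℝ (Fin d) × EuclideanSpace ℝ (Fin d) => I t p.1 p.2)
        ((densMeasure ρ0).prod (densMeasure ρ1)) = densMeasure (ρt t))
    (hρtC : ∀ t ∈ Icc (0:ℝ) 1, Continuous (ρt t))
    -- monotonicity and positivity of the interpolation coefficients
    (hda : ∀ t ∈ Icc (0:ℝ) 1, da t ≤ 0) (hdb : ∀ t ∈ Icc (0:ℝ) 1, 0 ≤ db t)
    (hapos : ∀ t ∈ Ico (0:ℝ) 1, 0 < a t) (hbpos : ∀ t ∈ Ioc (0:ℝ) 1, 0 < b t) :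
    ∀ t ∈ Ioo (0:ℝ) 1,
      (∀ x, HasDerivWithinAt (fun s => ρt s x)
        (-(db t / b t) * divg (fun y i => ρt t y * y i) x +
          (a t * (da t - db t / b t * a t)) * lap (ρt t) x) (Icc (0:ℝ) 1) t) ∧
      a t * (da t - db t / b t * a t) ≤ 0 := by
  intro t ht
  have hρ1i : Integrable ρ1 := .of_integral_ne_zero (by simp [hρ1m])
  have hprob : IsProbabilityMeasure (densMeasure ρ1) := ⟨by
    rw [densMeasure, withDensity_apply _ MeasurableSet.univ, Measure.restrict_univ,
      ← ofReal_integral_eq_lintegral_ofReal hρ1i (.of_forall hρ1nn), hρ1m, ENNReal.ofReal_one]⟩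
  have hρ0K : ρ0 = gaussKernel 1 := by
    ext x
    simp [hρ0, gaussKernel]
  have hap : ∀ s ∈ Ioo (0:ℝ) 1, 0 < a s := fun s hs => hapos s (Ioo_subset_Ico_self hs)
  have hbp : ∀ s ∈ Ioo (0:ℝ) 1, 0 < b s := fun s hs => hbpos s (Ioo_subset_Ioc_self hs)
  have hmix : ∀ s ∈ Ioo (0:ℝ) 1,
      ρt s = fun x => ∫ y, gaussKernel (a s) (x - b s • y) ∂(densMeasure ρ1) := fun s hs => by
    have hs' := Ioo_subset_Icc_self hs
    refine eq_of_densMeasure_eq (hρtC s hs') ?_ (fun x => ?_) ?_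
    · exact continuous_iff_continuousAt.2 fun x =>
        (fderiv_integral_gaussKernel _ (hap s hs) (b s) x).1.continuousAt
    · refine (integral_pos_iff_support_of_nonneg
        (fun y => (gaussKernel_pos (hap s hs) _).le)
        (integrable_gaussKernel _ (hap s hs) (b s) x)).2 ?_
      rw [Function.support_eq_univ fun y => (gaussKernel_pos (hap s hs) _).ne']
      simp
    · rw [← hρt s hs', ← map_gaussian_prod _ (hap s hs), hρ0K]
      simp only [hI]
  have hat := hap t ht
  have hbt := hbp t ht
  have hda0 := hda t (Ioo_subset_Icc_self ht)
  have hdb0 := hdb t (Ioo_subset_Icc_self ht)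
  refine ⟨fun x => ?_, ?_⟩
  · refine HasDerivAt.hasDerivWithinAt ?_
    have h := hasDerivAt_integral_gaussKernel (densMeasure ρ1) isOpen_Ioo
      (fun s _ => ha' s) (fun s _ => hb' s) (hdaC.mono Ioo_subset_Icc_self)
      (hdbC.mono Ioo_subset_Icc_self) hap hbp ht x
    refine (h.congr_of_eventuallyEq ?_).congr_deriv ?_
    · filter_upwards [isOpen_Ioo.mem_nhds ht] with s hs
      rw [hmix s hs]
    · rw [hmix t ht, divg_integral_gaussKernel _ hat, lap_integral_gaussKernel _ hat]
      field_simp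
      ring
  · have h1 : 0 ≤ db t / b t * a t := by positivity
    exact mul_nonpos_of_nonneg_of_nonpos hat.le (by linarith)
end
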